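/- arXiv:1905.00520 — 5 statements merged into one kernel-verified Lean document; each statement's English description precedes it below -/
import Mathlib

section
/- Let G be a finite group with core-free subgroups B and C such that G = BC (every element of G is a product b*c with b ∈ B, c ∈ C). If B is monolithic and C is cyclic, then G is almost simple; that is, G has a non-abelian simple normal subgroup S whose centralizer in G is trivial. -/
namespace MonoFact
open Subgroup
open scoped commutatorElement

/-- Theorem of Ito, computational core. -/
lemma ito_core {X : Type*} [Group X] (P Q : Subgroup X)
    (hP : ∀ x ∈ P, ∀ y ∈ P, x * y = y * x) (hQ : ∀ x ∈ Q, ∀ y ∈ Q, x * y = y * x)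
    (h : ∀ g : X, ∃ p ∈ P, ∃ q ∈ Q, g = p * q)   : Group.IsSolvable X := by
  have h' : ∀ g : X, ∃ q ∈ Q, ∃ p ∈ P, g = q * p := by
    intro g
    obtain ⟨p, hp, q, hq, e⟩ := h g⁻¹
    exact ⟨q⁻¹, Q.inv_mem hq, p⁻¹, P.inv_mem hp, by rw [← mul_inv_rev, ← e, inv_inv]⟩
  -- conjugation of a commutator by an element of P
  have c1 : ∀ a ∈ P, ∀ b ∈ Q, ∀ a1 ∈ P, ∀ a2 ∈ P, ∀ b2 ∈ Q, a1 * b * a1⁻¹ = b2 * a2 →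
      a1 * ⁅a, b⁆ * a1⁻¹ = ⁅a, b2⁆ := by
    intro a ha b hb a1 ha1 a2 ha2 b2 hb2 e
    have e1 : a1 * ⁅a, b⁆ * a1⁻¹ = ⁅a1 * a * a1⁻¹, a1 * b * a1⁻¹⁆ := by
      simp only [commutatorElement_def]; group
    rw [e1, e, hP a1 ha1 a ha]
    have e2 : a * a1 * a1⁻¹ = a := by group
    rw [e2]
    have e3 := hP a ha a2 ha2
    simp only [commutatorElement_def]
    have e4 : a2 * a⁻¹ * a2⁻¹ = a⁻¹ := by
      have := hP a2 ha2 a⁻¹ (P.inv_mem ha)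
      rw [this]; group
    calc a * (b2 * a2) * a⁻¹ * (b2 * a2)⁻¹ = a * b2 * (a2 * a⁻¹ * a2⁻¹) * b2⁻¹ := by group
      _ = _ := by rw [e4]
  have c2 : ∀ a ∈ P, ∀ b ∈ Q, ∀ b1 ∈ Q, ∀ a3 ∈ P, ∀ b3 ∈ Q, b1 * a * b1⁻¹ = a3 * b3 →
      b1 * ⁅a, b⁆ * b1⁻¹ = ⁅a3, b⁆ := by
    intro a ha b hb b1 hb1 a3 ha3 b3 hb3 e
    have e1 : b1 * ⁅a, b⁆ * b1⁻¹ = ⁅b1 * a * b1⁻¹, b1 * b * b1⁻¹⁆ := by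
      simp only [commutatorElement_def]; group
    rw [e1, e, hQ b1 hb1 b hb]
    have e2 : b * b1 * b1⁻¹ = b := by group
    rw [e2]
    simp only [commutatorElement_def]
    have e4 : b3 * b * b3⁻¹ = b := by
      rw [hQ b3 hb3 b hb]; group
    calc a3 * b3 * b * (a3 * b3)⁻¹ * b⁻¹ = a3 * (b3 * b * b3⁻¹) * a3⁻¹ * b⁻¹ := by group
      _ = _ := by rw [e4]
  -- commutators commute
  have key : ∀ a ∈ P, ∀ b ∈ Q, ∀ a1 ∈ P, ∀ b1 ∈ Q,
      ⁅a1⁻¹, b1⁻¹⁆ * ⁅a, b⁆ = ⁅a, b⁆ * ⁅a1⁻¹, b1⁻¹⁆ := by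
    intro a ha b hb a1 ha1 b1 hb1
    obtain ⟨b2, hb2, a2, ha2, e2⟩ := h' (a1 * b * a1⁻¹)
    obtain ⟨a3, ha3, b3, hb3, e3⟩ := h (b1 * a * b1⁻¹)
    have x1 : (a1 * b1) * ⁅a, b⁆ * (a1 * b1)⁻¹ = ⁅a3, b2⁆ := by
      calc _ = a1 * (b1 * ⁅a, b⁆ * b1⁻¹) * a1⁻¹ := by group
        _ = _ := by
          rw [c2 a ha b hb b1 hb1 a3 ha3 b3 hb3 e3, c1 a3 ha3 b hb a1 ha1 a2 ha2 b2 hb2 e2]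
    have x2 : (b1 * a1) * ⁅a, b⁆ * (b1 * a1)⁻¹ = ⁅a3, b2⁆ := by
      calc _ = b1 * (a1 * ⁅a, b⁆ * a1⁻¹) * b1⁻¹ := by group
        _ = _ := by
          rw [c1 a ha b hb a1 ha1 a2 ha2 b2 hb2 e2, c2 a ha b2 hb2 b1 hb1 a3 ha3 b3 hb3 e3]
    -- replace (a,b) by its conjugate under (b1 a1)⁻¹ 
    have x3 : (a1 * b1) * ⁅a, b⁆ * (a1 * b1)⁻¹ = (b1 * a1) * ⁅a, b⁆ * (b1 * a1)⁻¹ := by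
      rw [x1, x2]
    have x4 : ((b1 * a1)⁻¹ * (a1 * b1)) * ⁅a, b⁆ = ⁅a, b⁆ * ((b1 * a1)⁻¹ * (a1 * b1)) := by
      have := congrArg (fun z => (b1 * a1)⁻¹ * z * (a1 * b1)) x3
      calc _ = (b1 * a1)⁻¹ * (a1 * b1 * ⁅a, b⁆ * (a1 * b1)⁻¹) * (a1 * b1) := by group
        _ = _ := by rw [this]; group
    -- this is the commutator of inverses
    have x5 : (b1 * a1)⁻¹ * (a1 * b1) = ⁅a1⁻¹, b1⁻¹⁆ := by
      simp only [commutatorElement_def]; group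
    rw [x5] at x4
    exact x4
  have key2 : ∀ a ∈ P, ∀ b ∈ Q, ∀ a1 ∈ P, ∀ b1 ∈ Q,
      ⁅a1, b1⁆ * ⁅a, b⁆ = ⁅a, b⁆ * ⁅a1, b1⁆ := by
    intro a ha b hb a1 ha1 b1 hb1
    simpa using key a ha b hb a1⁻¹ (P.inv_mem ha1) b1⁻¹ (Q.inv_mem hb1)
  have hN : (⁅P, Q⁆ : Subgroup X).Normal := by
    rw [← normalizer_eq_top_iff, eq_top_iff]
    intro g _
    obtain ⟨p, hp, q, hq, rfl⟩ := h g
    exact mul_mem (normalizer_commutator_ge_left P Q hp) (normalizer_commutator_ge_right P Q hq)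
  have hcomm : ∀ x ∈ ⁅P, Q⁆, ∀ y ∈ ⁅P, Q⁆, x * y = y * x := by
    have h1 : ⁅P, Q⁆ ≤ centralizer ((⁅P, Q⁆ : Subgroup X) : Set X) := by
      rw [commutator_le]
      intro a ha b hb
      have h2 : ⁅P, Q⁆ ≤ centralizer ({⁅a, b⁆} : Set X) := by
        rw [commutator_le]
        intro a1 ha1 b1 hb1
        rw [mem_centralizer_iff]
        intro z hz
        rw [Set.mem_singleton_iff.mp hz]
        exact (key2 a ha b hb a1 ha1 b1 hb1).symm
      rw [mem_centralizer_iff]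
      intro z hz
      exact ((mem_centralizer_iff.mp (h2 hz)) _ rfl).symm
    intro x hx y hy
    exact ((mem_centralizer_iff.mp (h1 hx)) y hy).symm
  rw [Group.isSolvable_iff_subgroup_quotient ⁅P, Q⁆]
  constructor
  · exact Group.isSolvable_of_comm (fun a b => Subtype.ext (hcomm a a.2 b b.2))
  · apply Group.isSolvable_of_comm
    have hPQ : ∀ p ∈ P, ∀ q ∈ Q, Commute (p : X ⧸ ⁅P, Q⁆) (q : X ⧸ ⁅P, Q⁆) := by
      intro p hp q hq
      rw [← commutatorElement_eq_one_iff_commute]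
      exact (QuotientGroup.eq_one_iff _).mpr (commutator_mem_commutator hp hq)
    intro a b
    obtain ⟨x, rfl⟩ := QuotientGroup.mk_surjective a
    obtain ⟨y, rfl⟩ := QuotientGroup.mk_surjective b
    obtain ⟨p, hp, q, hq, rfl⟩ := h x
    obtain ⟨p', hp', q', hq', rfl⟩ := h y
    rw [QuotientGroup.mk_mul, QuotientGroup.mk_mul]
    have e1 : Commute (p : X ⧸ ⁅P, Q⁆) (p' : X ⧸ ⁅P, Q⁆) := by
      rw [commute_iff_eq, ← QuotientGroup.mk_mul, ← QuotientGroup.mk_mul, hP p hp p' hp']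
    have e2 : Commute (q : X ⧸ ⁅P, Q⁆) (q' : X ⧸ ⁅P, Q⁆) := by
      rw [commute_iff_eq, ← QuotientGroup.mk_mul, ← QuotientGroup.mk_mul, hQ q hq q' hq']
    exact ((e1.mul_right (hPQ p hp q' hq')).mul_left
      (((hPQ p' hp' q hq).symm).mul_right e2)).eq

/-- If `D` is abelian, normalizes `K`, `K ∩ B = 1` and `K ⊆ BD`, then `K` is soluble. -/
lemma solvable_of_inf_eq_bot {G : Type*} [Group G] (B K D : Subgroup G)
    (hD : ∀ x ∈ D, ∀ y ∈ D, x * y = y * x)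
    (hDK : ∀ d ∈ D, ∀ k ∈ K, d * k * d⁻¹ ∈ K)
    (hKB : ∀ x ∈ K, x ∈ B → x = 1)
    (hfac : ∀ x ∈ K, ∃ b ∈ B, ∃ d ∈ D, x = b * d) : Group.IsSolvable K := by
  let X : Subgroup G := 
    { carrier := {x | ∃ k ∈ K, ∃ d ∈ D, x = k * d}
      mul_mem' := by
        rintro _ _ ⟨k, hk, d, hd, rfl⟩ ⟨k', hk', d', hd', rfl⟩
        exact ⟨k * (d * k' * d⁻¹), mul_mem hk (hDK d hd k' hk'), d * d', mul_mem hd hd', by group⟩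
      one_mem' := ⟨1, one_mem _, 1, one_mem _, by simp⟩
      inv_mem' := by
        rintro _ ⟨k, hk, d, hd, rfl⟩
        refine ⟨d⁻¹ * k⁻¹ * d⁻¹⁻¹, hDK _ (inv_mem hd) _ (inv_mem hk), d⁻¹, inv_mem hd, by group⟩ }
  have hX : ∀ x, x ∈ X ↔ ∃ k ∈ K, ∃ d ∈ D, x = k * d := fun x => Iff.rfl
  have hKX : K ≤ X := fun k hk => ⟨k, hk, 1, one_mem _, by simp⟩
  have hDX : D ≤ X := fun d hd => ⟨1, one_mem _, d, hd, by simp⟩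
  have hXs : Group.IsSolvable X := by
    apply ito_core (B.subgroupOf X) (D.subgroupOf X)
    · rintro ⟨x, hx⟩ hxB ⟨y, hy⟩ hyB
      simp only [mem_subgroupOf] at hxB hyB
      apply Subtype.ext
      show x * y = y * x
      obtain ⟨k, hk, d, hd, e⟩ := hx
      obtain ⟨k', hk', d', hd', e'⟩ := hy
      have h1 : x * y * x⁻¹ * y⁻¹ ∈ B := mul_mem (mul_mem (mul_mem hxB hyB) (inv_mem hxB)) (inv_mem hyB)
      have h2 : x * y * x⁻¹ * y⁻¹ ∈ K := by
        have e4 : d * d' * d⁻¹ = d' := by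
          rw [hD d hd d' hd']; group
        have : x * y * x⁻¹ * y⁻¹ = k * (d * k' * d⁻¹) * (d' * k⁻¹ * d'⁻¹) * k'⁻¹ := by
          rw [e, e']
          calc k * d * (k' * d') * (k * d)⁻¹ * (k' * d')⁻¹
              = k * (d * k' * d⁻¹) * ((d * d' * d⁻¹) * k⁻¹ * d'⁻¹) * k'⁻¹ := by group
            _ = _ := by rw [e4]
        rw [this]
        exact mul_mem (mul_mem (mul_mem hk (hDK d hd k' hk')) (hDK d' hd' _ (inv_mem hk)))
          (inv_mem hk')
      have := hKB _ h2 h1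
      rwa [mul_inv_eq_one, mul_inv_eq_iff_eq_mul] at this
    · rintro ⟨x, hx⟩ hxB ⟨y, hy⟩ hyB
      exact Subtype.ext (hD x hxB y hyB)
    · rintro ⟨x, k, hk, d, hd, e⟩
      obtain ⟨b, hb, d', hd', e'⟩ := hfac k hk
      have hbX : b ∈ X := by
        have : b = k * d'⁻¹ := by rw [e']; group
        rw [this]; exact mul_mem (hKX hk) (hDX (inv_mem hd'))
      exact ⟨⟨b, hbX⟩, hb, ⟨d' * d, hDX (mul_mem hd' hd)⟩, mul_mem hd' hd, Subtype.ext (by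
        show x = b * (d' * d)
        rw [e, e']; group)⟩
  exact Group.isSolvable_of_isSolvable_injective (inclusion_injective hKX)

end MonoFact

namespace MonoFact
open Subgroup
open scoped commutatorElement

lemma geom_char {p : ℕ} [Fact p.Prime] {E : Type*} [Ring E] [Algebra (ZMod p) E] (β : E) (a : ℕ) :
    ∑ i ∈ Finset.range (p ^ a), β ^ i = (β - 1) ^ (p ^ a - 1) := by
  have hp : 0 < p ^ a := pow_pos (Fact.out : p.Prime).pos a
  have key : (∑ i ∈ Finset.range (p ^ a), (Polynomial.X : Polynomial (ZMod p)) ^ i)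
      = (Polynomial.X - 1) ^ (p ^ a - 1) := by
    have h1 : (Polynomial.X - 1 : Polynomial (ZMod p)) ≠ 0 := Polynomial.X_sub_C_ne_zero 1
    apply mul_right_cancel₀ h1
    rw [geom_sum_mul, ← pow_succ, Nat.sub_add_cancel hp, sub_pow_char_pow, one_pow]
  have := congrArg (Polynomial.aeval β) key
  simpa using this

lemma affine_aux {p : ℕ} [Fact p.Prime] {V : Type*} [AddCommGroup V] [Module (ZMod p) V] [Finite V]
    (β : V →ₗ[ZMod p] V) (κ : V) (s : ℕ → V) (hs0 : s 0 = 0) (hs : ∀ j, s (j + 1) = κ + β (s j))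
    (hsurj : ∀ v, ∃ j, s j = v) (hper : ∀ e, 0 < e → s e = 0 → Nat.card V ≤ e)
    (hq : s (Nat.card V) = 0) : Nat.card V = 1 ∨ Nat.card V = p ∨ Nat.card V = 4 := by
  have hp : p.Prime := Fact.out
  have hsum : ∀ j, s j = (∑ i ∈ Finset.range j, β ^ i) κ := by
    intro j
    induction j with
    | zero => simp [hs0]
    | succ j ih =>
      rw [hs, ih, geom_sum_succ]
      simp only [LinearMap.add_apply, Module.End.mul_apply, Module.End.one_apply]
      rw [add_comm]
  have : Fintype V := Fintype.ofFinite V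
  set d := Module.finrank (ZMod p) V with hd
  have hcard : Nat.card V = p ^ d := by
    rw [Nat.card_eq_fintype_card, Module.card_eq_pow_finrank (K := ZMod p), ZMod.card]
  have hpow : ∀ a, s (p ^ a) = ((β - 1) ^ (p ^ a - 1)) κ := by
    intro a; rw [hsum, geom_char]
  -- nilpotency
  have hnil : (β - 1) ^ (p ^ d - 1) = 0 := by
    ext v
    obtain ⟨j, rfl⟩ := hsurj v
    have h0 : ((β - 1) ^ (p ^ d - 1)) κ = 0 := by rw [← hpow, ← hcard, hq]
    have hc : Commute ((β - 1) ^ (p ^ d - 1)) (∑ i ∈ Finset.range j, β ^ i) := by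
      apply Commute.sum_right
      intro i _
      apply Commute.pow_pow
      exact (Commute.refl β).sub_left (Commute.one_left β)
    rw [hsum, ← Module.End.mul_apply, hc.eq, Module.End.mul_apply, h0]; simp
  have hnild : (β - 1) ^ d = 0 := by
    ext v
    have := Module.End.ker_pow_le_ker_pow_finrank (β - 1) (p ^ d - 1)
    have hv : v ∈ LinearMap.ker ((β - 1) ^ (p ^ d - 1)) := by simp [hnil]
    simpa using this hv
  by_cases hd1 : d ≤ 1
  · interval_cases hh : d
    · left; rw [hcard]; simp
    · right; left; rw [hcard]; simp
  push Not at hd1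
  have hle : p ^ (d - 1) ≤ d := by
    by_contra hlt
    push Not at hlt
    have : s (p ^ (d - 1)) = 0 := by
      rw [hpow, pow_eq_zero_of_le (by omega) hnild]; simp
    have h1 := hper _ (pow_pos hp.pos _) this
    rw [hcard] at h1
    have h2 : p ^ (d - 1) < p ^ d := Nat.pow_lt_pow_right hp.one_lt (by omega)
    omega
  right; right
  have hd2 : d = 2 := by
    by_contra hne
    have h3 : 3 ≤ d := by omega
    have h4 : 2 ^ (d - 1) ≤ d := (Nat.pow_le_pow_left hp.two_le _).trans hle
    have : ∀ n, 3 ≤ n → n < 2 ^ (n - 1) := by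
      intro n hn
      induction n, hn using Nat.le_induction with
      | base => norm_num
      | succ n hn ih =>
        obtain ⟨m, rfl⟩ : ∃ m, n = m + 1 := ⟨n - 1, by omega⟩
        simp only [Nat.add_sub_cancel] at *
        rw [pow_succ]; omega
    have := this d h3
    omega
  rw [hcard, hd2]
  rw [hd2] at hle
  have : p = 2 := by
    have := hp.two_le
    simp at hle; omega
  rw [this]; norm_num

lemma affine {p : ℕ} (hp : p.Prime) {V : Type*} [AddCommGroup V] [Finite V] (hpV : ∀ v : V, p • v = 0)
    (β : V →+ V) (κ : V) (s : ℕ → V) (hs0 : s 0 = 0) (hs : ∀ j, s (j + 1) = κ + β (s j))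
    (hsurj : ∀ v, ∃ j, s j = v) (hper : ∀ e, 0 < e → s e = 0 → Nat.card V ≤ e)
    (hq : s (Nat.card V) = 0) : Nat.card V = 1 ∨ Nat.card V = p ∨ Nat.card V = 4 := by
  have : Fact p.Prime := ⟨hp⟩
  let _ : Module (ZMod p) V := AddCommGroup.zmodModule hpV
  exact affine_aux (β.toZModLinearMap p) κ s hs0 (by simpa using hs) hsurj hper hq

lemma perm_fin3 : Group.IsSolvable (Equiv.Perm (Fin 3)) := by
  have h3 : Nat.card (alternatingGroup (Fin 3)) = 3 := by
    rw [nat_card_alternatingGroup]; simp [Nat.factorial]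
  have : Fact (Nat.Prime 3) := ⟨Nat.prime_three⟩
  have hc : IsCyclic (alternatingGroup (Fin 3)) := isCyclic_of_prime_card h3
  have hs : Group.IsSolvable (alternatingGroup (Fin 3)) := by
    let _ := hc.commGroup
    infer_instance
  exact Group.isSolvable_of_ker_le_range (alternatingGroup (Fin 3)).subtype Equiv.Perm.sign
    (by rw [Subgroup.range_subtype]; exact le_of_eq rfl)

lemma solv_mulAut_four {K : Type*} [Group K] (h : Nat.card K = 4) : Group.IsSolvable (MulAut K) := by
  classical
  have hfin : Finite K := Nat.finite_of_card_ne_zero (by omega)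
  have : Fintype K := Fintype.ofFinite K
  have hc : Nat.card {x : K // x ≠ 1} = 3 := by
    rw [Nat.card_eq_fintype_card, Fintype.card_subtype_compl, ← Nat.card_eq_fintype_card, h]
    simp
  let e : {x : K // x ≠ 1} ≃ Fin 3 := Finite.equivFinOfCardEq hc
  have hs : Group.IsSolvable (Equiv.Perm {x : K // x ≠ 1}) := by
    have := perm_fin3
    exact Group.isSolvable_of_isSolvable_injective (f := (e.permCongrHom).toMonoidHom)
      e.permCongrHom.injective
  let f : MulAut K →* Equiv.Perm {x : K // x ≠ 1} :=
    { toFun := fun α => (α.toEquiv).subtypeEquiv (fun a => by simp)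
      map_one' := by ext x; rfl
      map_mul' := fun a b => by ext x; rfl }
  refine Group.isSolvable_of_isSolvable_injective (f := f) ?_
  intro a b hab
  ext x
  by_cases hx : x = 1
  · simp [hx]
  · exact congrArg Subtype.val (DFunLike.congr_fun hab ⟨x, hx⟩)

lemma solv_mulAut_prime {p : ℕ} (hp : p.Prime) {K : Type*} [Group K] (h : Nat.card K = p) :
    Group.IsSolvable (MulAut K) := by
  have : Fact p.Prime := ⟨hp⟩
  have hc : IsCyclic K := isCyclic_of_prime_card h
  exact Group.isSolvable_of_isSolvable_injective (f := (IsCyclic.mulAutMulEquiv K).toMonoidHom)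
    (IsCyclic.mulAutMulEquiv K).injective

lemma perfect_hom {X Y : Type*} [Group X] [Group Y] (hX : commutator X = ⊤) (hY : Group.IsSolvable Y)
    (f : X →* Y) (x : X) : f x = 1 := by
  have hd : ∀ n, derivedSeries X n = ⊤ := by
    intro n
    induction n with
    | zero => rfl
    | succ n ih => rw [derivedSeries_succ, ih]; exact hX
  obtain ⟨n, hn⟩ := hY.solvable
  have := map_derivedSeries_le_derivedSeries f n
  rw [hn, hd n] at this
  have h2 : f x ∈ (⊥ : Subgroup Y) := this (Subgroup.mem_map_of_mem f (Subgroup.mem_top x))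
  simpa using h2

lemma perfect_coe {G : Type*} [Group G] (A : Subgroup G) (hA : A ≤ ⁅A, A⁆) :
    commutator A = ⊤ := by
  apply Subgroup.map_injective A.subtype_injective
  rw [commutator_def, Subgroup.map_commutator]
  simp only [← MonoidHom.range_eq_map, Subgroup.range_subtype]
  exact le_antisymm (Subgroup.commutator_le.2 fun a ha b hb =>
    A.mul_mem (A.mul_mem (A.mul_mem ha hb) (A.inv_mem ha)) (A.inv_mem hb)) hA

/-- a perfect subgroup normalising `K` with solvable automorphism group centralises it -/
lemma perfect_cent {G : Type*} [Group G] (A K : Subgroup G) (hA : A ≤ ⁅A, A⁆) (hK : K.Normal)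
    (hs : Group.IsSolvable (MulAut K)) : ∀ a ∈ A, ∀ k ∈ K, a * k = k * a := by
  intro a ha k hk
  have h := perfect_hom (perfect_coe A hA) hs
    ((MulAut.conjNormal (H := K)).comp A.subtype) ⟨a, ha⟩
  have h2 := congrArg Subtype.val (DFunLike.congr_fun h ⟨k, hk⟩)
  simp at h2
  exact mul_inv_eq_iff_eq_mul.1 h2

end MonoFact

namespace MonoFact
open Subgroup
open scoped commutatorElement

/-- the standing hypotheses -/
structure Setup {G : Type*} [Group G] (B C A : Subgroup G) : Prop where
  fact : ∀ g : G, ∃ b ∈ B, ∃ c ∈ C, g = b * c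
  cyc : IsCyclic ↥C
  ccf : ∀ N : Subgroup G, N.Normal → N ≤ C → N = ⊥
  bcf : ∀ N : Subgroup G, N.Normal → N ≤ B → N = ⊥
  AB : A ≤ B
  Ane : A ≠ ⊥
  Anorm : ∀ b ∈ B, ∀ a ∈ A, b * a * b⁻¹ ∈ A
  Amin : ∀ N : Subgroup G, N ≤ B → (∀ b ∈ B, ∀ n ∈ N, b * n * b⁻¹ ∈ N) → N ≠ ⊥ → A ≤ N
  Anc : ∃ a ∈ A, ∃ a' ∈ A, a * a' ≠ a' * a

lemma card_le_of {G : Type*} [Group G] [Finite G] (P Q B : Subgroup G)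
    (h : ∀ x ∈ P, ∃ y ∈ Q, ∃ b ∈ B, x = y * b) (hPB : ∀ x ∈ P, x ∈ B → x = 1) :
    Nat.card P ≤ Nat.card Q := by
  choose! f hf g hg e using h
  refine Nat.card_le_card_of_injective (fun x : P => (⟨f x, hf x x.2⟩ : Q)) ?_
  intro x y hxy
  have h1 : f x = f y := congrArg Subtype.val hxy
  have h2 : (x : G)⁻¹ * y ∈ B := by
    rw [e x x.2, e y y.2, h1]
    have : (f ↑y * g ↑x)⁻¹ * (f ↑y * g ↑y) = (g x)⁻¹ * g y := by group
    rw [this]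
    exact B.mul_mem (B.inv_mem (hg x x.2)) (hg y y.2)
  have := hPB _ (P.mul_mem (P.inv_mem x.2) y.2) h2
  exact Subtype.ext (inv_mul_eq_one.1 this)

lemma normalClosure_le_of {G : Type*} [Group G] (x : G) (H : Subgroup G)
    (h : ∀ g : G, g * x * g⁻¹ ∈ H) : normalClosure {x} ≤ H := by
  rw [normalClosure, closure_le]
  intro y hy
  obtain ⟨z, hz, hc⟩ := Group.mem_conjugatesOfSet_iff.1 hy
  obtain ⟨g, hg⟩ := isConj_iff.1 hc
  rw [Set.mem_singleton_iff] at hz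
  subst hz
  rw [← hg]; exact h g

lemma mem_sup_normal {G : Type*} [Group G] {K B : Subgroup G} (hK : K.Normal) {x : G} :
    x ∈ K ⊔ B ↔ ∃ k ∈ K, ∃ b ∈ B, x = k * b := by
  constructor
  · intro h
    have : x ∈ ((K ⊔ B : Subgroup G) : Set G) := h
    rw [Subgroup.normal_mul] at this
    obtain ⟨k, hk, b, hb, e⟩ := this
    exact ⟨k, hk, b, hb, e.symm⟩
  · rintro ⟨k, hk, b, hb, rfl⟩
    exact mul_mem (le_sup_left (a := K) hk) (le_sup_right (a := K) hb)

namespace Setup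
variable {G : Type*} [Group G] {B C A : Subgroup G}

lemma comm (h : Setup B C A) : ∀ x ∈ C, ∀ y ∈ C, x * y = y * x := by
  intro x hx y hy
  have := h.cyc
  let _ := this.commGroup
  exact congrArg Subtype.val (mul_comm (⟨x, hx⟩ : C) ⟨y, hy⟩)

lemma fact' (h : Setup B C A) (g : G) : ∃ c ∈ C, ∃ b ∈ B, g = c * b := by
  obtain ⟨b, hb, c, hc, e⟩ := h.fact g⁻¹
  exact ⟨c⁻¹, C.inv_mem hc, b⁻¹, B.inv_mem hb, by rw [← mul_inv_rev, ← e, inv_inv]⟩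

lemma inter (h : Setup B C A) {x : G} (hxB : x ∈ B) (hxC : x ∈ C) : x = 1 := by
  have h1 : normalClosure {x} ≤ B := by
    apply normalClosure_le_of
    intro g
    obtain ⟨b, hb, c, hc, rfl⟩ := h.fact g
    have : b * c * x * (b * c)⁻¹ = b * x * b⁻¹ := by
      rw [mul_assoc b c x, h.comm c hc x hxC]; group
    rw [this]
    exact B.mul_mem (B.mul_mem hb hxB) (B.inv_mem hb)
  have h2 := h.bcf _ normalClosure_normal h1
  have h3 : x ∈ normalClosure {x} := subset_normalClosure (Set.mem_singleton x)
  rw [h2] at h3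
  exact h3

lemma perf (h : Setup B C A) : A ≤ ⁅A, A⁆ := by
  apply h.Amin
  · refine Subgroup.commutator_le.2 fun a ha b hb => ?_
    have ha := h.AB ha
    have hb := h.AB hb
    exact B.mul_mem (B.mul_mem (B.mul_mem ha hb) (B.inv_mem ha)) (B.inv_mem hb)
  · intro b hb n hn
    have : Subgroup.map (MulAut.conj b).toMonoidHom ⁅A, A⁆ ≤ ⁅A, A⁆ := by
      rw [Subgroup.map_commutator]
      have hm : Subgroup.map (MulAut.conj b).toMonoidHom A ≤ A := by
        rintro _ ⟨a, ha, rfl⟩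
        exact h.Anorm b hb a ha
      exact Subgroup.commutator_mono hm hm
    exact this ⟨n, hn, rfl⟩
  · intro hbot
    obtain ⟨a, ha, a', ha', hne⟩ := h.Anc
    have : ⁅a, a'⁆ ∈ ⁅A, A⁆ := Subgroup.commutator_mem_commutator ha ha'
    rw [hbot, Subgroup.mem_bot, commutatorElement_eq_one_iff_mul_comm] at this
    exact hne this

/-- a minimal normal subgroup avoiding `B` is centralised by `A` -/
lemma cent_of_min [Finite G] (h : Setup B C A) (K : Subgroup G) (hK : K.Normal) (hne : K ≠ ⊥)
    (hmin : ∀ L : Subgroup G, L.Normal → L ≤ K → L ≠ ⊥ → L = K)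
    (hKB : ∀ x ∈ K, x ∈ B → x = 1) :
    (∀ x ∈ K, ∀ y ∈ K, x * y = y * x) ∧ ∀ a ∈ A, ∀ k ∈ K, a * k = k * a := by
  have hsol : Group.IsSolvable K :=
    solvable_of_inf_eq_bot B K C h.comm (fun d _ k hk => hK.conj_mem k hk d) hKB
      (fun x _ => h.fact x)
  have hcomm : ∀ x ∈ K, ∀ y ∈ K, x * y = y * x := by
    have hb : ⁅K, K⁆ = ⊥ := by
      by_contra hb
      have := hmin ⁅K, K⁆ inferInstance (Subgroup.commutator_le_left K K) hb
      have hperf := perfect_hom (perfect_coe K this.ge) hsol (MonoidHom.id K)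
      apply hne
      rw [eq_bot_iff]
      intro x hx
      exact congrArg Subtype.val (hperf ⟨x, hx⟩)
    intro x hx y hy
    have : ⁅x, y⁆ ∈ ⁅K, K⁆ := Subgroup.commutator_mem_commutator hx hy
    rwa [hb, Subgroup.mem_bot, commutatorElement_eq_one_iff_mul_comm] at this
  refine ⟨hcomm, ?_⟩
  have hcard1 : Nat.card K ≠ 1 := by
    intro h1; exact hne (Subgroup.card_eq_one.1 h1)
  obtain ⟨p, hp, hpd⟩ := Nat.exists_prime_and_dvd hcard1
  have hfp : Fact p.Prime := ⟨hp⟩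
  obtain ⟨x0, hx0⟩ := exists_prime_orderOf_dvd_card' (G := K) p hpd
  have hexp : ∀ x ∈ K, x ^ p = 1 := by
    let L : Subgroup G :=
      { carrier := {x | x ∈ K ∧ x ^ p = 1}
        one_mem' := ⟨K.one_mem, one_pow p⟩
        mul_mem' := by
          rintro a b ⟨ha, ha'⟩ ⟨hb, hb'⟩
          refine ⟨K.mul_mem ha hb, ?_⟩
          rw [(show Commute a b from hcomm a ha b hb).mul_pow, ha', hb', one_mul]
        inv_mem' := by
          rintro a ⟨ha, ha'⟩
          exact ⟨K.inv_mem ha, by rw [inv_pow, ha', inv_one]⟩ }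
    have hL : L.Normal := ⟨by
      rintro n ⟨hn, hn'⟩ g
      exact ⟨hK.conj_mem n hn g, by rw [conj_pow, hn']; group⟩⟩
    have hLK := hmin L hL (fun x hx => hx.1) (by
      intro hb
      have : (x0 : G) ∈ L := ⟨x0.2, by
        have := pow_orderOf_eq_one x0
        rw [hx0] at this
        exact congrArg Subtype.val this⟩
      rw [hb, Subgroup.mem_bot] at this
      have h1 : x0 = 1 := Subtype.ext this
      rw [h1, orderOf_one] at hx0
      exact hp.one_lt.ne hx0)
    intro x hx
    rw [← hLK] at hx
    exact hx.2
  -- the cyclic group D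
  have hDcyc : IsCyclic (C ⊓ (K ⊔ B) : Subgroup G) := by
    have := h.cyc
    exact isCyclic_of_injective (Subgroup.inclusion (inf_le_left : C ⊓ (K ⊔ B) ≤ C))
      (Subgroup.inclusion_injective _)
  set D : Subgroup G := C ⊓ (K ⊔ B) with hD
  obtain ⟨⟨d0, hd0⟩, hgen⟩ := hDcyc.exists_generator
  have hgen' : ∀ d ∈ D, ∃ j : ℕ, d0 ^ j = d := by
    intro d hd
    have := hgen ⟨d, hd⟩
    rw [← mem_powers_iff_mem_zpowers] at this
    obtain ⟨j, hj⟩ := this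
    exact ⟨j, congrArg Subtype.val hj⟩
  have hordD : orderOf d0 = Nat.card D := by
    have := orderOf_eq_card_of_forall_mem_zpowers hgen
    rw [← this]
    exact (Subgroup.orderOf_mk d0 hd0).symm
  have hDB : ∀ x ∈ D, x ∈ B → x = 1 := fun x hx hxB => h.inter hxB hx.1
  have hKD : ∀ x ∈ K, ∃ y ∈ D, ∃ b ∈ B, x = y * b := by
    intro x hx
    obtain ⟨c, hc, b, hb, rfl⟩ := h.fact' x
    refine ⟨c, ⟨hc, (mem_sup_normal hK).2 ⟨c * b, hx, b⁻¹, B.inv_mem hb, by group⟩⟩, b, hb, rfl⟩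
  have hcardKD : Nat.card K = Nat.card D :=
    le_antisymm (card_le_of K D B hKD hKB)
      (card_le_of D K B (fun x hx => (mem_sup_normal hK).1 hx.2) hDB)
  obtain ⟨κ, hκ, b0, hb0, e0⟩ := (mem_sup_normal hK).1 hd0.2
  let icg : CommGroup K :=
    { (inferInstance : Group K) with
      mul_comm := fun a b => Subtype.ext (hcomm a a.2 b b.2) }
  let s : ℕ → K := fun j => Nat.rec 1 (fun _ x => ⟨κ, hκ⟩ * MulAut.conjNormal b0 x) j
  have hs : ∀ j : ℕ, ∃ b ∈ B, d0 ^ j = (s j).1 * b := by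
    intro j
    induction j with
    | zero => exact ⟨1, B.one_mem, by simp [s]⟩
    | succ j ih =>
      obtain ⟨b, hb, e⟩ := ih
      refine ⟨b0 * b, B.mul_mem hb0 hb, ?_⟩
      have : (s (j + 1)).1 = κ * (b0 * (s j).1 * b0⁻¹) := rfl
      rw [pow_succ', e, this, e0]
      group
  have hres : Nat.card (Additive K) = 1 ∨ Nat.card (Additive K) = p ∨ Nat.card (Additive K) = 4 := by
    refine affine hp (V := Additive K) ?_
      (MonoidHom.toAdditive ((MulAut.conjNormal (H := K) b0).toMonoidHom))
      (Additive.ofMul ⟨κ, hκ⟩) (fun j => Additive.ofMul (s j)) rfl (fun j => rfl) ?_ ?_ ?_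
    · intro v
      have : (Additive.toMul v) ^ p = 1 := Subtype.ext (hexp _ (Additive.toMul v).2)
      exact this
    · intro v
      obtain ⟨d, hd, b, hb, e⟩ := hKD _ (Additive.toMul v).2
      obtain ⟨j, rfl⟩ := hgen' d hd
      obtain ⟨b', hb', e'⟩ := hs j
      refine ⟨j, ?_⟩
      have hm : ((s j)⁻¹ * (Additive.toMul v) : K) = 1 := by
        apply Subtype.ext
        apply hKB _ (Subtype.mem _)
        have : (((s j)⁻¹ * (Additive.toMul v) : K) : G) = b' * b := by
          rw [Subgroup.coe_mul, Subgroup.coe_inv, e, e']; group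
        rw [this]
        exact B.mul_mem hb' hb
      have hm2 : s j = Additive.toMul v := inv_mul_eq_one.1 hm
      exact hm2
    · intro e he hse
      obtain ⟨b', hb', e'⟩ := hs e
      have h1 : s e = 1 := hse
      have h2 : d0 ^ e = 1 := hDB _ (D.pow_mem hd0 e) (by rw [e', h1]; simpa using hb')
      have h3 := Nat.le_of_dvd he (orderOf_dvd_of_pow_eq_one h2)
      rw [hordD, ← hcardKD] at h3
      exact h3
    · obtain ⟨b', hb', e'⟩ := hs (Nat.card K)
      have h2 : d0 ^ Nat.card K = 1 := by
        rw [hcardKD, ← hordD]; exact pow_orderOf_eq_one d0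
      rw [h2] at e'
      have : s (Nat.card K) = 1 := by
        apply Subtype.ext
        apply hKB _ (Subtype.mem _)
        rw [eq_inv_of_mul_eq_one_left e'.symm]
        exact B.inv_mem hb'
      exact this
  apply perfect_cent A K h.perf hK
  rcases hres with hr | hr | hr
  · exact absurd hr hcard1
  · exact solv_mulAut_prime hp hr
  · exact solv_mulAut_four hr

end Setup
end MonoFact

namespace MonoFact
open Subgroup
open scoped commutatorElement

lemma exists_min_subgroup {G : Type*} [Group G] [Finite G] (P : Subgroup G → Prop) (N : Subgroup G)
    (hN : P N) : ∃ K, P K ∧ K ≤ N ∧ ∀ L, P L → L ≤ K → L = K := by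
  obtain ⟨K, hKN, hK⟩ := (Set.toFinite {K : Subgroup G | P K}).exists_le_minimal hN
  exact ⟨K, hK.1, hKN, fun L hL hLK => le_antisymm hLK (hK.2 hL hLK)⟩

namespace Setup
variable {G : Type*} [Group G] {B C A : Subgroup G}

lemma A_le_of_meets (h : Setup B C A) (N : Subgroup G) (hN : ∀ b ∈ B, ∀ n ∈ N, b * n * b⁻¹ ∈ N)
    (hx : ∃ x ∈ N, x ∈ B ∧ x ≠ 1) : A ≤ N := by
  refine le_trans (h.Amin (N ⊓ B) inf_le_right ?_ ?_) inf_le_left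
  · intro b hb n hn
    exact ⟨hN b hb n hn.1, B.mul_mem (B.mul_mem hb hn.2) (B.inv_mem hb)⟩
  · obtain ⟨x, hx, hxB, hx1⟩ := hx
    intro hb
    have : x ∈ N ⊓ B := ⟨hx, hxB⟩
    rw [hb, Subgroup.mem_bot] at this
    exact hx1 this

/-- every nontrivial normal subgroup contains `A` -/
lemma A_le_normal [Finite G] (h : Setup B C A) (N : Subgroup G) (hN : N.Normal) (hne : N ≠ ⊥) :
    A ≤ N := by
  apply h.A_le_of_meets N (fun b _ n hn => hN.conj_mem n hn b)
  by_contra hcon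
  push Not at hcon
  obtain ⟨K, ⟨hK, hKne⟩, hKN, hmin⟩ :=
    exists_min_subgroup (fun L : Subgroup G => L.Normal ∧ L ≠ ⊥) N ⟨hN, hne⟩
  have hKB : ∀ x ∈ K, x ∈ B → x = 1 := fun x hx hxB => hcon x (hKN hx) hxB
  obtain ⟨hKcomm, hAK⟩ := h.cent_of_min K hK hKne (fun L h1 h2 h3 => hmin L ⟨h1, h3⟩ h2) hKB
  -- a normal subgroup strictly between K and KB
  have hN0 : ∃ N0 : Subgroup G, N0.Normal ∧ K ≤ N0 ∧ N0 ≤ K ⊔ B ∧ ¬ N0 ≤ K := by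
    by_contra hc
    push Not at hc
    have hCK : ∀ c ∈ C, c ∈ K ⊔ B → c ∈ K := by
      intro c hcC hc2
      have h1 : normalClosure {c} ≤ K ⊔ B := by
        apply normalClosure_le_of
        intro g
        obtain ⟨b, hb, c', hc', rfl⟩ := h.fact g
        have : b * c' * c * (b * c')⁻¹ = b * c * b⁻¹ := by
          rw [mul_assoc b c' c, h.comm c' hc' c hcC]; group
        rw [this]
        have hb' : b ∈ K ⊔ B := le_sup_right (a := K) hb
        exact mul_mem (mul_mem hb' hc2) (inv_mem hb')
      have h2 := hc (K ⊔ normalClosure {c}) inferInstance le_sup_left (sup_le le_sup_left h1)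
      exact h2 (le_sup_right (a := K) (subset_normalClosure (Set.mem_singleton c)))
    apply hKne
    apply h.ccf K hK
    intro x hx
    obtain ⟨b, hb, c, hc', rfl⟩ := h.fact x
    have hcK : c ∈ K := by
      apply hCK c hc'
      have h1 : b⁻¹ ∈ K ⊔ B := le_sup_right (a := K) (B.inv_mem hb)
      have h2 : b * c ∈ K ⊔ B := le_sup_left (a := K) hx
      have := mul_mem h1 h2
      simpa using this
    have hbK : b ∈ K := by
      have := K.mul_mem hx (K.inv_mem hcK)
      simpa using this
    rw [hKB b hbK hb, one_mul]
    exact hc'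
  obtain ⟨N0, hN0n, hKN0, hN0B, hN0K⟩ := hN0
  have hAN0 : A ≤ N0 := by
    apply h.A_le_of_meets N0 (fun b _ n hn => hN0n.conj_mem n hn b)
    obtain ⟨x, hx, hxK⟩ := SetLike.not_le_iff_exists.1 hN0K
    obtain ⟨k, hk, b, hb, rfl⟩ := (mem_sup_normal hK).1 (hN0B hx)
    refine ⟨b, ?_, hb, ?_⟩
    · have := N0.mul_mem (N0.inv_mem (hKN0 hk)) hx
      simpa using this
    · rintro rfl
      exact hxK (by simpa using hk)
  set N1 : Subgroup G := N0 ⊓ centralizer (K : Set G) with hN1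
  have hN1n : N1.Normal := inferInstance
  have hAN1 : A ≤ N1 := by
    refine le_inf hAN0 ?_
    intro a ha
    rw [mem_centralizer_iff]
    intro k hk
    exact (hAK a ha k hk).symm
  have hcom : ⁅N1, N1⁆ ≤ B := by
    refine Subgroup.commutator_le.2 ?_
    intro x hx y hy
    obtain ⟨k, hk, b, hb, rfl⟩ := (mem_sup_normal hK).1 (hN0B hx.1)
    obtain ⟨l, hl, b', hb', rfl⟩ := (mem_sup_normal hK).1 (hN0B hy.1)
    have hx2 := mem_centralizer_iff.1 hx.2
    have hy2 := mem_centralizer_iff.1 hy.2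
    have e1 : ∀ z ∈ K, z * b = b * z := by
      intro z hz
      have h1 := hx2 z hz
      have h2 := hKcomm z hz k hk
      rw [← mul_assoc, h2, mul_assoc, mul_assoc] at h1
      exact mul_left_cancel h1
    have e2 : ∀ z ∈ K, z * b' = b' * z := by
      intro z hz
      have h1 := hy2 z hz
      have h2 := hKcomm z hz l hl
      rw [← mul_assoc, h2, mul_assoc, mul_assoc] at h1
      exact mul_left_cancel h1
    have e3 : ⁅k * b, l * b'⁆ = ⁅b, b'⁆ := by
      rw [commutatorElement_def, commutatorElement_def]
      have a1 : k * b * (l * b') = (b * b') * (k * l) := by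
        rw [e1 k hk, mul_assoc b k, ← mul_assoc k l b', e2 _ (K.mul_mem hk hl)]
        group
      have a2 : (l * b') * (k * b) = (b' * b) * (k * l) := by
        rw [e2 l hl, mul_assoc b' l, ← mul_assoc l k b, e1 _ (K.mul_mem hl hk), hKcomm l hl k hk]
        group
      calc k * b * (l * b') * (k * b)⁻¹ * (l * b')⁻¹
          = (k * b * (l * b')) * ((l * b') * (k * b))⁻¹ := by group
        _ = b * b' * b⁻¹ * b'⁻¹ := by rw [a1, a2]; group
    rw [e3, commutatorElement_def]
    exact B.mul_mem (B.mul_mem (B.mul_mem hb hb') (B.inv_mem hb)) (B.inv_mem hb')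
  have hbot := h.bcf ⁅N1, N1⁆ inferInstance hcom
  obtain ⟨a, ha, a', ha', hne'⟩ := h.Anc
  have : ⁅a, a'⁆ ∈ ⁅N1, N1⁆ := Subgroup.commutator_mem_commutator (hAN1 ha) (hAN1 ha')
  rw [hbot, Subgroup.mem_bot, commutatorElement_eq_one_iff_mul_comm] at this
  exact hne' this

end Setup
end MonoFact

namespace MonoFact
open Subgroup

lemma dvd_card_of_period {X : Type*} [Finite X] (f : Equiv.Perm X) (q : ℕ)
    (h : ∀ x n, (f ^ n) x = x → q ∣ n) : q ∣ Nat.card X := by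
  classical
  have : Fintype X := Fintype.ofFinite X
  rw [Nat.card_congr (MulAction.selfEquivSigmaOrbits (Subgroup.zpowers f) X), Nat.card_sigma]
  apply Finset.dvd_sum
  intro ω _
  induction ω using Quotient.inductionOn' with
  | h x =>
  have hx : ∀ y : X, q ∣ Nat.card (MulAction.orbit (Subgroup.zpowers f) y) := by
    intro y
    rw [Nat.card_eq_fintype_card, ← MulAction.minimalPeriod_eq_card]
    apply h y
    have := Function.iterate_minimalPeriod (f := (fun x => f • x)) (x := y)
    rw [Equiv.Perm.coe_pow]
    exact this
  exact hx _

lemma two_card_primeFactors_le (c : ℕ) (hc : 0 < c) : 2 * c.primeFactors.card ≤ c := by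
  have h1 : 2 ^ c.primeFactors.card ≤ c := by
    calc 2 ^ c.primeFactors.card = ∏ p ∈ c.primeFactors, 2 := by simp
      _ ≤ ∏ p ∈ c.primeFactors, p :=
        Finset.prod_le_prod' fun p hp => (Nat.prime_of_mem_primeFactors hp).two_le
      _ ≤ c := Nat.le_of_dvd hc (Nat.prod_primeFactors_dvd c)
  refine le_trans ?_ h1
  generalize c.primeFactors.card = n
  cases n with
  | zero => simp
  | succ n =>
    have := Nat.lt_two_pow_self (n := n)
    rw [pow_succ]; omega

lemma two_card_lcm (m : Multiset ℕ) (hm : ∀ x ∈ m, 0 < x) : 2 * m.lcm.primeFactors.card ≤ m.sum := by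
  induction m using Multiset.induction with
  | empty => simp
  | cons a m ih =>
    have ha := hm a (Multiset.mem_cons_self a m)
    have hm' : ∀ x ∈ m, 0 < x := fun x hx => hm x (Multiset.mem_cons_of_mem hx)
    have hl : m.lcm ≠ 0 := by
      rw [Ne, Multiset.lcm_eq_zero_iff]
      intro h0; exact lt_irrefl 0 (hm' 0 h0)
    rw [Multiset.lcm_cons, Multiset.sum_cons]
    have : (GCDMonoid.lcm a m.lcm).primeFactors = a.primeFactors ∪ m.lcm.primeFactors :=
      by
        ext p
        simp only [Finset.mem_union, Nat.mem_primeFactors]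
        constructor
        · rintro ⟨hp, hd, -⟩
          rcases (Nat.Prime.dvd_lcm hp).1 hd with h | h
          · exact Or.inl ⟨hp, h, ha.ne'⟩
          · exact Or.inr ⟨hp, h, hl⟩
        · rintro (⟨hp, hd, -⟩ | ⟨hp, hd, -⟩)
          · exact ⟨hp, hd.trans (dvd_lcm_left _ _), Nat.lcm_ne_zero ha.ne' hl⟩
          · exact ⟨hp, hd.trans (dvd_lcm_right _ _), Nat.lcm_ne_zero ha.ne' hl⟩
    rw [this]
    have h1 := Finset.card_union_le a.primeFactors m.lcm.primeFactors
    have h2 := two_card_primeFactors_le a ha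
    have h3 := ih hm'
    omega

lemma two_card_support {X : Type*} [Fintype X] [DecidableEq X] (σ : Equiv.Perm X) :
    2 * (orderOf σ).primeFactors.card ≤ σ.support.card := by
  rw [← Equiv.Perm.lcm_cycleType, ← Equiv.Perm.sum_cycleType]
  apply two_card_lcm
  intro x hx
  have := Equiv.Perm.two_le_of_mem_cycleType hx
  omega

/-- the automorphism `α` acting on cosets of an invariant proper subgroup -/
lemma index_bound {S : Type*} [Group S] [Finite S] [IsSimpleGroup S] (α : MulAut S) (H : Subgroup S)
    (hH : H ≠ ⊤) (hα : ∀ x, α x ∈ H ↔ x ∈ H) : 2 * (orderOf α).primeFactors.card + 1 ≤ H.index := by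
  classical
  have : Fintype (S ⧸ H) := Fintype.ofFinite _
  let σ : Equiv.Perm (S ⧸ H) := Quotient.congr α.toEquiv (by
    intro a b
    rw [QuotientGroup.leftRel_apply, QuotientGroup.leftRel_apply]
    have : (α.toEquiv a)⁻¹ * α.toEquiv b = α (a⁻¹ * b) := by simp
    rw [this, hα])
  have hσ : ∀ x : S, σ (x : S ⧸ H) = ((α x : S) : S ⧸ H) := fun x => rfl
  have hσn : ∀ (n : ℕ) (x : S), (σ ^ n) (x : S ⧸ H) = (((α ^ n) x : S) : S ⧸ H) := by
    intro n
    induction n with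
    | zero => intro x; rfl
    | succ n ih =>
      intro x
      rw [pow_succ, pow_succ, Equiv.Perm.mul_apply, hσ, ih]; rfl
  have hcore : H.normalCore = ⊥ := by
    rcases (normalCore_normal H).eq_bot_or_eq_top with h | h
    · exact h
    · exact absurd (top_le_iff.1 (h ▸ normalCore_le H)) hH
  have hord : orderOf σ = orderOf α := by
    rw [orderOf_eq_orderOf_iff]
    intro n
    constructor
    · intro hn
      have hfix : ∀ x : S, x⁻¹ * (α ^ n) x ∈ H := by
        intro x
        rw [← QuotientGroup.eq, ← hσn, hn]; rfl
      ext s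
      have hs : s⁻¹ * (α ^ n) s ∈ H.normalCore := by
        intro x
        have h1 := hfix (s * x⁻¹)
        have h2 := H.inv_mem (hfix x⁻¹)
        have := H.mul_mem h1 h2
        simp only [map_mul, map_inv, mul_inv_rev, inv_inv] at this
        convert this using 1
        group
      rw [hcore, Subgroup.mem_bot] at hs
      exact (inv_mul_eq_one.1 hs).symm
    · intro hn
      ext x
      induction x using QuotientGroup.induction_on with
      | H x => rw [hσn, hn]; rfl
  rw [← hord]
  have h1 := two_card_support σ
  have h2 : σ.support ⊆ Finset.univ.erase ((1 : S) : S ⧸ H) := by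
    intro y hy
    rw [Finset.mem_erase]
    refine ⟨?_, Finset.mem_univ _⟩
    rintro rfl
    rw [Equiv.Perm.mem_support, hσ, map_one] at hy
    exact hy rfl
  have h3 := Finset.card_le_card h2
  rw [Finset.card_erase_of_mem (Finset.mem_univ _), Finset.card_univ] at h3
  rw [Subgroup.index, Nat.card_eq_fintype_card]
  have : 0 < Fintype.card (S ⧸ H) := Fintype.card_pos
  omega

lemma card_ne_two {S : Type*} [Group S] (hnc : ∃ x y : S, x * y ≠ y * x) : Nat.card S ≠ 2 := by
  intro h
  have : Fact (Nat.Prime 2) := ⟨Nat.prime_two⟩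
  have hc : IsCyclic S := isCyclic_of_prime_card h
  obtain ⟨x, y, hxy⟩ := hnc
  let _ := hc.commGroup
  exact hxy (mul_comm x y)

/-- the order of an automorphism of a non-abelian simple group -/
lemma orderOf_mulAut {S : Type*} [Group S] [Finite S] [IsSimpleGroup S]
    (hnc : ∃ x y : S, x * y ≠ y * x) (α : MulAut S) :
    orderOf α < Nat.card S ∧ 2 * orderOf α ≠ Nat.card S := by
  classical
  have : Fintype S := Fintype.ofFinite S
  have hfin : Finite (MulAut S) := Finite.of_injective (fun a : MulAut S => (a : S → S))
    DFunLike.coe_injective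
  set e := orderOf α with he
  have he0 : 0 < e := orderOf_pos α
  have hS1 : 1 < Nat.card S := Finite.one_lt_card
  by_cases he1 : e = 1
  · rw [he1]
    exact ⟨hS1, fun h => card_ne_two hnc (by omega)⟩
  let Cf : ℕ → Subgroup S := fun p =>
    { carrier := {x | (α ^ (e / p)) x = x}
      one_mem' := map_one _
      mul_mem' := by intro a b ha hb; simp only [Set.mem_ofPred_eq] at *; rw [map_mul, ha, hb]
      inv_mem' := by intro a ha; simp only [Set.mem_ofPred_eq] at *; rw [map_inv, ha] }
  have hCf : ∀ p x, x ∈ Cf p ↔ (α ^ (e / p)) x = x := fun p x => Iff.rfl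
  have hinv : ∀ p x, α x ∈ Cf p ↔ x ∈ Cf p := by
    intro p x
    rw [hCf, hCf, ← MulAut.mul_apply, ← pow_succ, pow_succ', MulAut.mul_apply, EmbeddingLike.apply_eq_iff_eq]
  have hprop : ∀ p ∈ e.primeFactors, Cf p ≠ ⊤ := by
    intro p hp htop
    have hpp := Nat.prime_of_mem_primeFactors hp
    have hpd := Nat.dvd_of_mem_primeFactors hp
    have h1 : α ^ (e / p) = 1 := by
      ext x
      have : x ∈ Cf p := by rw [htop]; exact mem_top x
      exact this
    have h2 := Nat.le_of_dvd (Nat.div_pos (Nat.le_of_dvd he0 hpd) hpp.pos) (orderOf_dvd_of_pow_eq_one h1)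
    have h3 := Nat.div_lt_self he0 hpp.one_lt
    omega
  set w := e.primeFactors.card with hw
  have hidx : ∀ p ∈ e.primeFactors, (2 * w + 1) * Nat.card (Cf p) ≤ Nat.card S := by
    intro p hp
    rw [← Subgroup.index_mul_card (Cf p)]
    exact Nat.mul_le_mul_right _ (index_bound α (Cf p) (hprop p hp) (hinv p))
  let U : Finset S := e.primeFactors.biUnion (fun p => Finset.univ.filter (fun x => x ∈ Cf p))
  have hU : (2 * w + 1) * U.card ≤ w * Nat.card S := by
    calc (2 * w + 1) * U.card
        ≤ (2 * w + 1) * ∑ p ∈ e.primeFactors, (Finset.univ.filter (fun x => x ∈ Cf p)).card :=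
          Nat.mul_le_mul_left _ Finset.card_biUnion_le
      _ = ∑ p ∈ e.primeFactors, (2 * w + 1) * (Finset.univ.filter (fun x => x ∈ Cf p)).card :=
          Finset.mul_sum _ _ _
      _ ≤ ∑ p ∈ e.primeFactors, Nat.card S := by
          apply Finset.sum_le_sum
          intro p hp
          have hcc : Nat.card (Cf p) = (Finset.univ.filter (fun x => x ∈ Cf p)).card := by
            rw [Nat.card_eq_fintype_card, Fintype.card_subtype]
          rw [← hcc]
          exact hidx p hp
      _ = w * Nat.card S := by simp [hw]
  have hU2 : 2 * U.card < Nat.card S := by nlinarith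
  have hmemU : ∀ x, x ∈ U ↔ ∃ p ∈ e.primeFactors, x ∈ Cf p := by
    intro x; simp [U]
  have h1U : (1 : S) ∈ U := by
    rw [hmemU]
    obtain ⟨p, hp, hpd⟩ := Nat.exists_prime_and_dvd he1
    exact ⟨p, Nat.mem_primeFactors.2 ⟨hp, hpd, he0.ne'⟩, one_mem _⟩
  have hUpos : 0 < U.card := Finset.card_pos.2 ⟨1, h1U⟩
  have hinvU : ∀ x, α.toEquiv x ∉ U ↔ x ∉ U := by
    intro x
    rw [not_iff_not, hmemU, hmemU]
    exact exists_congr fun p => and_congr_right fun _ => hinv p x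
  have hR : e ∣ Nat.card {x // x ∉ U} := by
    apply dvd_card_of_period (Equiv.Perm.subtypePerm α.toEquiv hinvU)
    rintro ⟨x, hx⟩ n hn
    have hpow : ∀ k : ℕ, (((Equiv.Perm.subtypePerm α.toEquiv hinvU) ^ k) ⟨x, hx⟩ : {x // x ∉ U}).1 = (α ^ k) x := by
      intro k
      induction k with
      | zero => rfl
      | succ k ih =>
        rw [pow_succ', pow_succ', Equiv.Perm.mul_apply, MulAut.mul_apply, ← ih]; rfl
    have hn' : (α ^ n) x = x := by rw [← hpow, hn]
    -- the period
    by_contra hndvd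
    have hg : (α ^ (Nat.gcd n e)) x = x := by
      have h1 : Function.IsPeriodicPt α n x := by
        have : (⇑(α ^ n)) = (⇑α)^[n] := by
          clear hn hn' hndvd
          induction n with
          | zero => rfl
          | succ n ih => rw [pow_succ, Function.iterate_succ, ← ih]; rfl
        show (⇑α)^[n] x = x
        rw [← this, hn']
      have hit : ∀ m : ℕ, (⇑(α ^ m)) = (⇑α)^[m] := by
        intro m
        induction m with
        | zero => rfl
        | succ m ih => rw [pow_succ, Function.iterate_succ, ← ih]; rfl
      have h2 : Function.IsPeriodicPt α e x := by
        show (⇑α)^[e] x = x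
        rw [← hit, he, pow_orderOf_eq_one]; rfl
      have h3 : (⇑α)^[Nat.gcd n e] x = x := h1.gcd h2
      rw [hit, h3]
    have hge : Nat.gcd n e ∣ e := Nat.gcd_dvd_right n e
    have hgne : e / Nat.gcd n e ≠ 1 := by
      intro h
      have : Nat.gcd n e = e := by
        have := Nat.div_mul_cancel hge
        rw [h, one_mul] at this
        exact this
      exact hndvd (Nat.gcd_eq_right_iff_dvd.1 this)
    obtain ⟨p, hp, hpd⟩ := Nat.exists_prime_and_dvd hgne
    have hpe : p ∣ e := hpd.trans (Nat.div_dvd_of_dvd hge)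
    apply hx
    rw [hmemU]
    refine ⟨p, Nat.mem_primeFactors.2 ⟨hp, hpe, he0.ne'⟩, ?_⟩
    rw [hCf]
    have hd : Nat.gcd n e ∣ e / p := by
      obtain ⟨t, ht⟩ := hpd
      have h1 := Nat.div_mul_cancel hge
      rw [ht] at h1
      refine ⟨t, ?_⟩
      apply Nat.div_eq_of_eq_mul_left hp.pos
      exact (h1.symm.trans (by ring))
    obtain ⟨t, ht⟩ := hd
    rw [ht, pow_mul]
    generalize α ^ (Nat.gcd n e) = γ at hg
    clear ht
    induction t with
    | zero => rfl
    | succ t ih => rw [pow_succ, MulAut.mul_apply, hg, ih]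
  have hRcard : Nat.card {x // x ∉ U} = Nat.card S - U.card := by
    rw [Nat.card_eq_fintype_card, Nat.card_eq_fintype_card, Fintype.card_subtype_compl]
    simp
  rw [hRcard] at hR
  have hle := Nat.le_of_dvd (by omega) hR
  refine ⟨by omega, ?_⟩
  intro h2
  obtain ⟨t, ht⟩ := hR
  have : e * t < e * 2 := by omega
  have h3 : e * 1 < e * t := by omega
  have := Nat.lt_of_mul_lt_mul_left this
  have := Nat.lt_of_mul_lt_mul_left h3
  omega

end MonoFact

namespace MonoFact

lemma perm_inv_self {X : Type*} (f : Equiv.Perm X) (x : X) : f⁻¹ (f x) = x := f.symm_apply_apply x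
lemma perm_self_inv {X : Type*} (f : Equiv.Perm X) (x : X) : f (f⁻¹ x) = x := f.apply_symm_apply x

lemma exists_prime_pow_part (m : ℕ) (hm : 3 ≤ m) :
    ∃ p a u : ℕ, p.Prime ∧ m = p ^ a * u ∧ ¬ p ∣ u ∧ 3 ≤ p ^ a := by
  rcases Nat.eq_two_pow_or_exists_odd_prime_and_dvd m with ⟨k, rfl⟩ | ⟨p, hp, hpm, hodd⟩
  · exact ⟨2, k, 1, Nat.prime_two, by simp, by norm_num, hm⟩
  · obtain ⟨a, u, hu, rfl⟩ := Nat.exists_eq_pow_mul_and_not_dvd (n := m) (by omega) p hp.ne_one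
    refine ⟨p, a, u, hp, rfl, hu, ?_⟩
    have hp3 : 3 ≤ p := by
      have := hp.two_le
      rcases hodd with ⟨t, ht⟩
      omega
    have ha : a ≠ 0 := by
      rintro rfl
      simp at hpm
      exact hu hpm
    exact hp3.trans (Nat.le_self_pow ha p)

lemma not_pow_dvd_lcm {p E : ℕ} (hp : p.Prime) {a b : ℕ} (ha : ¬ p ^ E ∣ a) (hb : ¬ p ^ E ∣ b) :
    ¬ p ^ E ∣ Nat.lcm a b := by
  have ha0 : a ≠ 0 := by rintro rfl; exact ha (dvd_zero _)
  have hb0 : b ≠ 0 := by rintro rfl; exact hb (dvd_zero _)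
  rw [hp.pow_dvd_iff_le_factorization ha0] at ha
  rw [hp.pow_dvd_iff_le_factorization hb0] at hb
  rw [hp.pow_dvd_iff_le_factorization (Nat.lcm_ne_zero ha0 hb0), Nat.factorization_lcm ha0 hb0]
  simp only [Finsupp.sup_apply, le_sup_iff]
  tauto

lemma not_pow_dvd_finset_lcm {p E : ℕ} (hp : p.Prime) (hE : E ≠ 0) {I : Type*} [DecidableEq I]
    (s : Finset I) (n : I → ℕ)
    (h : ∀ i, ¬ p ^ E ∣ n i) : ¬ p ^ E ∣ s.lcm n := by
  induction s using Finset.induction with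
  | empty =>
    rw [Finset.lcm_empty, Nat.dvd_one]
    intro h1
    exact hp.one_lt.ne' ((Nat.pow_eq_one.1 h1).resolve_right hE)
  | insert a s ha ih =>
    rw [Finset.lcm_insert]
    exact not_pow_dvd_lcm hp (h a) ih

lemma wl_abs {Λ I : Type*} [Finite Λ] [Finite I] (π : Λ → I) (f : Equiv.Perm Λ) (g : Equiv.Perm I)
    (hπ : ∀ x, π (f x) = g (π x)) (m : ℕ) (hm : 3 ≤ m) (hfib : ∀ i, Nat.card {x // π x = i} = m)
    (htrans : ∀ ω ω' : I → Λ, (∀ i, π (ω i) = i) → (∀ i, π (ω' i) = i) →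
      ∃ j : ℕ, ∀ i, (f ^ j) (ω i) = ω' ((g ^ j) i)) : Nat.card I ≤ 1 := by
  classical
  have : Fintype Λ := Fintype.ofFinite Λ
  have : Fintype I := Fintype.ofFinite I
  have hπn : ∀ (n : ℕ) x, π ((f ^ n) x) = (g ^ n) (π x) := by
    intro n
    induction n with
    | zero => intro x; rfl
    | succ n ih => intro x; rw [pow_succ, pow_succ, Equiv.Perm.mul_apply, ih, hπ]; rfl
  by_contra hk
  push Not at hk
  set k := Nat.card I with hkdef
  -- Claim A
  have hA : ∀ ω : I → Λ, (∀ i, π (ω i) = i) → ∀ n : ℕ, (∀ i, (f ^ n) (ω i) = ω i) → m ^ k ∣ n := by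
    intro ω hω n hn
    let F : Equiv.Perm {ω : I → Λ // ∀ i, π (ω i) = i} :=
      { toFun := fun ω => ⟨fun i => f (ω.1 (g⁻¹ i)), fun i => by rw [hπ, ω.2]; simp⟩
        invFun := fun ω => ⟨fun i => f⁻¹ (ω.1 (g i)), fun i => by
          apply g.injective
          rw [← hπ, ← ω.2 (g i)]; simp⟩
        left_inv := fun ω => by ext i; simp
        right_inv := fun ω => by ext i; simp }
    have hF : ∀ (j : ℕ) ω i, ((F ^ j) ω).1 ((g ^ j) i) = (f ^ j) (ω.1 i) := by
      intro j
      induction j with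
      | zero => intro ω i; rfl
      | succ j ih =>
        intro ω i
        rw [pow_succ' F, pow_succ' g, pow_succ' f]
        simp only [Equiv.Perm.mul_apply]
        rw [← ih]
        change f (((F ^ j) ω).1 (g⁻¹ (g ((g ^ j) i)))) = _
        rw [perm_inv_self]
    have hcard : Nat.card {ω : I → Λ // ∀ i, π (ω i) = i} = m ^ k := by
      rw [Nat.card_congr (Equiv.subtypePiEquivPi (p := fun i (x : Λ) => π x = i)), Nat.card_pi]
      simp only [hfib]
      simp [hkdef, Nat.card_eq_fintype_card]
    have hfix : (F ^ n) ⟨ω, hω⟩ = ⟨ω, hω⟩ := by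
      apply Subtype.ext
      funext i
      have h1 : (g ^ n) i = i := by
        have := hπn n (ω i)
        rw [hn, hω] at this
        exact this.symm
      have h2 := hF n ⟨ω, hω⟩ i
      rw [h1] at h2
      rw [h2, hn]
    have hper : Function.minimalPeriod (fun x => F • x) (⟨ω, hω⟩ : {ω : I → Λ // ∀ i, π (ω i) = i})
        = m ^ k := by
      rw [MulAction.minimalPeriod_eq_card, ← Nat.card_eq_fintype_card, ← hcard]
      have : MulAction.orbit (Subgroup.zpowers F) (⟨ω, hω⟩ : {ω : I → Λ // ∀ i, π (ω i) = i})
          = Set.univ := by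
        rw [Set.eq_univ_iff_forall]
        rintro ⟨ω', hω'⟩
        obtain ⟨j, hj⟩ := htrans ω ω' hω hω'
        refine ⟨⟨F ^ j, ⟨j, by simp⟩⟩, ?_⟩
        apply Subtype.ext
        funext i
        have h2 := hF j ⟨ω, hω⟩ ((g ^ j)⁻¹ i)
        rw [perm_self_inv] at h2
        change ((F ^ j) ⟨ω, hω⟩).1 i = ω' i
        rw [h2, hj, perm_self_inv]
      rw [this, Nat.card_congr (Equiv.Set.univ _)]
    rw [← hper]
    apply Function.IsPeriodicPt.minimalPeriod_dvd
    change (fun x => F • x)^[n] _ = _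
    have : (fun x => F • x) = ⇑F := rfl
    rw [this, ← Equiv.Perm.coe_pow, hfix]
  obtain ⟨p, a, u, hp, hmu, hu, hq⟩ := exists_prime_pow_part m hm
  have ha : a ≠ 0 := by rintro rfl; simp at hq
  -- Claim C
  have hC : ∃ i0, ∀ x, π x = i0 → ∀ n : ℕ, (f ^ n) x = x → p ^ (a * k) ∣ n := by
    by_contra hcon
    push Not at hcon
    choose x hx n hn hnd using hcon
    have h1 := hA x hx (Finset.univ.lcm n) (by
      intro i
      obtain ⟨t, ht⟩ := Finset.dvd_lcm (f := n) (Finset.mem_univ i)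
      rw [ht, pow_mul]
      have hni := hn i
      generalize f ^ n i = γ at hni
      clear ht
      induction t with
      | zero => rfl
      | succ t ih => rw [pow_succ, Equiv.Perm.mul_apply, hni, ih])
    refine not_pow_dvd_finset_lcm hp (E := a * k) (by positivity) Finset.univ n hnd (dvd_trans ?_ h1)
    rw [hmu, mul_pow, ← pow_mul]
    exact dvd_mul_right _ _
  obtain ⟨i0, hi0⟩ := hC
  -- Claim D
  let P : I → Prop := fun i => g.SameCycle i0 i
  have hPg : ∀ x, P (π (f x)) ↔ P (π x) := by
    intro x
    rw [hπ]
    exact Equiv.Perm.sameCycle_apply_right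
  have hD : p ^ (a * k) ∣ Nat.card {x // P (π x)} := by
    apply dvd_card_of_period (Equiv.Perm.subtypePerm f hPg)
    rintro ⟨x, hx⟩ n hn
    rw [Equiv.Perm.subtypePerm_pow] at hn
    have hn' : (f ^ n) x = x := congrArg Subtype.val hn
    obtain ⟨j, hj⟩ := hx.exists_nat_pow_eq
    have hy : π ((f ^ j)⁻¹ x) = i0 := by
      apply (g ^ j).injective
      rw [← hπn, perm_self_inv, hj]
    apply hi0 _ hy n
    have hc : f ^ n * (f ^ j)⁻¹ = (f ^ j)⁻¹ * f ^ n :=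
      ((Commute.refl f).pow_pow n j).inv_right.eq
    rw [← Equiv.Perm.mul_apply, hc, Equiv.Perm.mul_apply, hn']
  set ℓ := (Finset.univ.filter P).card with hℓ
  have hcardX : Nat.card {x // P (π x)} = ℓ * m := by
    rw [Nat.card_eq_fintype_card, Fintype.card_subtype]
    rw [Finset.card_eq_sum_card_fiberwise (f := π) (t := Finset.univ.filter P)]
    · rw [hℓ, Finset.card_eq_sum_ones, Finset.sum_mul]
      apply Finset.sum_congr rfl
      intro i hi
      rw [one_mul, ← hfib i, Nat.card_eq_fintype_card, Fintype.card_subtype]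
      congr 1
      ext x
      simp only [Finset.mem_filter, Finset.mem_univ, true_and] at hi ⊢
      constructor
      · exact fun h => h.2
      · rintro rfl; exact ⟨hi, rfl⟩
    · intro x hx
      simpa using hx
  have hℓk : ℓ ≤ k := by
    rw [hkdef, Nat.card_eq_fintype_card]
    exact Finset.card_le_univ _
  have hℓ0 : 0 < ℓ := Finset.card_pos.2 ⟨i0, by simp [P, Equiv.Perm.SameCycle.refl]⟩
  rw [hcardX, hmu] at hD
  have hpa : 0 < p ^ a := pow_pos hp.pos a
  have h1 : p ^ (a * (k - 1)) ∣ ℓ := by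
    have e1 : p ^ (a * k) = p ^ a * p ^ (a * (k - 1)) := by
      rw [← pow_add]; congr 1
      obtain ⟨t, ht⟩ : ∃ t, k = t + 1 := ⟨k - 1, by omega⟩
      rw [ht]; simp; ring
    rw [e1, show ℓ * (p ^ a * u) = p ^ a * (ℓ * u) by ring] at hD
    have h2 := Nat.dvd_of_mul_dvd_mul_left hpa hD
    refine Nat.Coprime.dvd_of_dvd_mul_right ?_ h2
    exact Nat.Coprime.pow_left _ ((Nat.Prime.coprime_iff_not_dvd hp).2 hu)
  have h2 := Nat.le_of_dvd hℓ0 h1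
  rw [pow_mul] at h2
  have h3 : 3 ^ (k - 1) ≤ (p ^ a) ^ (k - 1) := Nat.pow_le_pow_left hq _
  have h4 : ∀ t, t + 2 < 3 ^ (t + 1) := by
    intro t
    induction t with
    | zero => norm_num
    | succ t ih => rw [pow_succ]; omega
  have h5 := h4 (k - 2)
  rw [show k - 2 + 1 = k - 1 by omega] at h5
  omega

end MonoFact

namespace MonoFact
open Subgroup
open scoped commutatorElement

/-- conjugate subgroup -/
def cj {G : Type*} [Group G] (g : G) (H : Subgroup G) : Subgroup G :=
  H.map (MulAut.conj g).toMonoidHom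

/-- `T` is normalised by `M` -/
def Nz {G : Type*} [Group G] (M T : Subgroup G) : Prop := ∀ m ∈ M, ∀ t ∈ T, m * t * m⁻¹ ∈ T

section basic
variable {G : Type*} [Group G]

lemma mem_cj {g : G} {H : Subgroup G} {x : G} : x ∈ cj g H ↔ g⁻¹ * x * g ∈ H := by
  unfold cj
  rw [Subgroup.mem_map]
  constructor
  · rintro ⟨y, hy, rfl⟩
    have : g⁻¹ * ((MulAut.conj g).toMonoidHom y) * g = y := by
      change g⁻¹ * (g * y * g⁻¹) * g = y
      group
    rw [this]; exact hy
  · intro h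
    refine ⟨_, h, ?_⟩
    change g * (g⁻¹ * x * g) * g⁻¹ = x
    group

lemma conj_mem_cj {g : G} {H : Subgroup G} {x : G} (hx : x ∈ H) : g * x * g⁻¹ ∈ cj g H := by
  rw [mem_cj]; convert hx using 1; group

lemma cj_mul (g h : G) (H : Subgroup G) : cj (g * h) H = cj g (cj h H) := by
  ext x
  rw [mem_cj, mem_cj, mem_cj]
  have : (g * h)⁻¹ * x * (g * h) = h⁻¹ * (g⁻¹ * x * g) * h := by group
  rw [this]

lemma cj_one (H : Subgroup G) : cj 1 H = H := by
  ext x; rw [mem_cj]; simp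

lemma cj_inv_cj (g : G) (H : Subgroup G) : cj g⁻¹ (cj g H) = H := by
  rw [← cj_mul, inv_mul_cancel, cj_one]

lemma cj_cj_inv (g : G) (H : Subgroup G) : cj g (cj g⁻¹ H) = H := by
  rw [← cj_mul, mul_inv_cancel, cj_one]

lemma cj_inj {g : G} {H K : Subgroup G} : cj g H = cj g K ↔ H = K := by
  constructor
  · intro h; rw [← cj_inv_cj g H, h, cj_inv_cj]
  · rintro rfl; rfl

lemma cj_mono {g : G} {H K : Subgroup G} (h : H ≤ K) : cj g H ≤ cj g K := by
  intro x hx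
  rw [mem_cj] at *
  exact h hx

lemma cj_le_iff {g : G} {H K : Subgroup G} : cj g H ≤ K ↔ H ≤ cj g⁻¹ K := by
  constructor
  · intro h; have := cj_mono (g := g⁻¹) h; rwa [cj_inv_cj] at this
  · intro h; have := cj_mono (g := g) h; rwa [cj_cj_inv] at this

lemma cj_bot (g : G) : cj g (⊥ : Subgroup G) = ⊥ := Subgroup.map_bot _

lemma cj_ne_bot {g : G} {H : Subgroup G} (h : H ≠ ⊥) : cj g H ≠ ⊥ := by
  intro h'
  rw [← cj_bot g, cj_inj] at h'
  exact h h'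

lemma cj_normal {g : G} {H : Subgroup G} (h : H.Normal) : cj g H = H := by
  ext x
  rw [mem_cj]
  constructor
  · intro hx
    have := h.conj_mem _ hx g
    convert this using 1; group
  · intro hx
    have := h.conj_mem _ hx g⁻¹
    convert this using 1; group

lemma Nz.cj_eq {M T : Subgroup G} (h : Nz M T) {m : G} (hm : m ∈ M) : cj m T = T := by
  ext x
  rw [mem_cj]
  constructor
  · intro hx
    have := h m hm _ hx
    convert this using 1; group
  · intro hx
    have := h m⁻¹ (M.inv_mem hm) _ hx
    convert this using 1; group

lemma conj_mem_of_cj_eq {T : Subgroup G} {m : G} (h : cj m T = T) {t : G} (ht : t ∈ T) :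
    m * t * m⁻¹ ∈ T := by
  have := conj_mem_cj (g := m) ht
  rwa [h] at this

lemma nz_iff {M T : Subgroup G} : Nz M T ↔ M ≤ normalizer (T : Set G) := by
  constructor
  · intro h m hm
    rw [mem_normalizer_iff]
    intro x
    constructor
    · exact h m hm x
    · intro hx
      have := h m⁻¹ (M.inv_mem hm) _ hx
      convert this using 1; group
  · intro h m hm t ht
    exact (mem_normalizer_iff.1 (h hm) t).1 ht

lemma Nz.mono {M M' T : Subgroup G} (h : Nz M T) (hM : M' ≤ M) : Nz M' T :=
  fun m hm => h m (hM hm)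

lemma nz_sSup {X : Set (Subgroup G)} {T : Subgroup G} (h : ∀ H ∈ X, Nz H T) : Nz (sSup X) T := by
  rw [nz_iff]
  exact sSup_le fun H hH => nz_iff.1 (h H hH)

lemma nz_sup {H K : Subgroup G} {T : Subgroup G} (h : Nz H T) (h' : Nz K T) : Nz (H ⊔ K) T := by
  rw [nz_iff] at *
  exact sup_le h h'

lemma nz_of_normal {M T : Subgroup G} (h : T.Normal) : Nz M T := fun m _ t ht => h.conj_mem t ht m

lemma nz_inf {M T T' : Subgroup G} (h : Nz M T) (h' : Nz M T') : Nz M (T ⊓ T') :=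
  fun m hm t ht => ⟨h m hm t ht.1, h' m hm t ht.2⟩

lemma nz_self (T : Subgroup G) : Nz T T := fun m hm t ht => T.mul_mem (T.mul_mem hm ht) (T.inv_mem hm)

lemma nz_cj {M T : Subgroup G} (g : G) (h : Nz M T) : Nz (cj g M) (cj g T) := by
  intro m hm t ht
  rw [mem_cj] at *
  have := h _ hm _ ht
  convert this using 1; group

lemma nz_target_sSup {M : Subgroup G} {X : Set (Subgroup G)} (h : ∀ T ∈ X, Nz M T) :
    Nz M (sSup X) := by
  intro m hm
  have : sSup X ≤ cj m⁻¹ (sSup X) := by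
    apply sSup_le
    intro T hT
    rw [← cj_le_iff, (h T hT).cj_eq hm]
    exact le_sSup hT
  rw [← cj_le_iff] at this
  intro t ht
  exact this (conj_mem_cj ht)

/-- mul decomposition of a sup, second factor normalised by the first -/
lemma mem_sup_nz {K B : Subgroup G} (h : Nz B K) {x : G} :
    x ∈ K ⊔ B ↔ ∃ k ∈ K, ∃ b ∈ B, x = k * b := by
  constructor
  · intro hx
    have : x ∈ ((K ⊔ B : Subgroup G) : Set G) := hx
    rw [sup_comm, Subgroup.coe_mul_of_left_le_normalizer_right B K (nz_iff.1 h)] at this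
    obtain ⟨b, hb, k, hk, e⟩ := this
    refine ⟨b * k * b⁻¹, h b hb k hk, b, hb, ?_⟩
    rw [← e]; simp
  · rintro ⟨k, hk, b, hb, rfl⟩
    exact mul_mem (le_sup_left (a := K) hk) (le_sup_right (a := K) hb)

lemma mem_sup_nz' {K B : Subgroup G} (h : Nz B K) {x : G} :
    x ∈ K ⊔ B ↔ ∃ b ∈ B, ∃ k ∈ K, x = b * k := by
  rw [← inv_mem_iff, mem_sup_nz h]
  constructor
  · rintro ⟨k, hk, b, hb, e⟩
    exact ⟨b⁻¹, B.inv_mem hb, k⁻¹, K.inv_mem hk, by rw [← mul_inv_rev, ← e, inv_inv]⟩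
  · rintro ⟨b, hb, k, hk, e⟩
    exact ⟨k⁻¹, K.inv_mem hk, b⁻¹, B.inv_mem hb, by rw [← mul_inv_rev, ← e]⟩

/-- commuting subgroups -/
def Cm (H K : Subgroup G) : Prop := ∀ h ∈ H, ∀ k ∈ K, h * k = k * h

lemma cm_iff {H K : Subgroup G} : Cm H K ↔ H ≤ centralizer (K : Set G) := by
  constructor
  · intro h x hx
    rw [mem_centralizer_iff]
    intro k hk
    exact (h x hx k hk).symm
  · intro h x hx k hk
    exact (mem_centralizer_iff.1 (h hx) k hk).symm

lemma Cm.symm {H K : Subgroup G} (h : Cm H K) : Cm K H := fun k hk x hx => (h x hx k hk).symm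

lemma cm_sSup {X : Set (Subgroup G)} {K : Subgroup G} (h : ∀ H ∈ X, Cm H K) : Cm (sSup X) K := by
  rw [cm_iff]
  exact sSup_le fun H hH => cm_iff.1 (h H hH)

lemma cm_sup {H H' : Subgroup G} {K : Subgroup G} (h : Cm H K) (h' : Cm H' K) : Cm (H ⊔ H') K := by
  rw [cm_iff] at *
  exact sup_le h h'

lemma Cm.mono {H H' K K' : Subgroup G} (h : Cm H K) (hH : H' ≤ H) (hK : K' ≤ K) : Cm H' K' :=
  fun x hx k hk => h x (hH hx) k (hK hk)

lemma Cm.nz {H K : Subgroup G} (h : Cm H K) : Nz H K := fun x hx k hk => by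
  rw [h x hx k hk]; simpa using hk

lemma cj_cm {H K : Subgroup G} (g : G) (h : Cm H K) : Cm (cj g H) (cj g K) := by
  intro x hx y hy
  rw [mem_cj] at *
  have := h _ hx _ hy
  have h1 : g * (g⁻¹ * x * g * (g⁻¹ * y * g)) * g⁻¹ = x * y := by group
  have h2 : g * (g⁻¹ * y * g * (g⁻¹ * x * g)) * g⁻¹ = y * x := by group
  rw [← h1, this, h2]

lemma cj_sSup (g : G) (X : Set (Subgroup G)) : cj g (sSup X) = sSup (cj g '' X) := by
  apply le_antisymm
  · rw [cj_le_iff]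
    apply sSup_le
    intro T hT
    rw [← cj_le_iff]
    exact le_sSup ⟨T, hT, rfl⟩
  · apply sSup_le
    rintro _ ⟨T, hT, rfl⟩
    exact cj_mono (le_sSup hT)

lemma commutator_mem_inf {T T' : Subgroup G} (h : Nz T T') (h' : Nz T' T) (hb : T ⊓ T' = ⊥) :
    Cm T T' := by
  intro x hx y hy
  have h1 : x * y * x⁻¹ * y⁻¹ ∈ T ⊓ T' := by
    constructor
    · have := T.mul_mem hx (h' y hy _ (T.inv_mem hx))
      rw [show x * y * x⁻¹ * y⁻¹ = x * (y * x⁻¹ * y⁻¹) by group]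
      exact this
    · exact T'.mul_mem (h x hx y hy) (T'.inv_mem hy)
  rw [hb, Subgroup.mem_bot] at h1
  rw [mul_inv_eq_one, mul_inv_eq_iff_eq_mul] at h1
  exact h1

end basic

/-- the simple factors of the socle `M` -/
structure Comps {G : Type*} [Group G] (B C A M : Subgroup G) (𝓘 : Set (Subgroup G)) : Prop where
  stp : Setup B C A
  Mn : M.Normal
  AM : A ≤ M
  Mmin : ∀ N : Subgroup G, N.Normal → N ≠ ⊥ → M ≤ N
  Mcent : ∀ x, (∀ m ∈ M, x * m = m * x) → x = 1
  Mperf : M ≤ ⁅M, M⁆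
  MB : ¬ M ≤ B
  conj : ∀ g, ∀ T ∈ 𝓘, cj g T ∈ 𝓘
  le : ∀ T ∈ 𝓘, T ≤ M
  nor : ∀ T ∈ 𝓘, Nz M T
  ne : ∀ T ∈ 𝓘, T ≠ ⊥
  simp : ∀ T ∈ 𝓘, ∀ L : Subgroup G, L ≤ T → L ≠ ⊥ → Nz T L → L = T
  comm : ∀ T ∈ 𝓘, ∀ T' ∈ 𝓘, T ≠ T' → Cm T T'
  sup : sSup 𝓘 = M
  nonab : ∀ T ∈ 𝓘, ∃ x ∈ T, ∃ y ∈ T, x * y ≠ y * x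
  trans : ∀ T ∈ 𝓘, ∀ T' ∈ 𝓘, ∃ g, cj g T = T'
  nonemp : 𝓘.Nonempty

lemma exists_comps {G : Type*} [Group G] [Finite G] {B C A : Subgroup G} (h : Setup B C A) :
    ∃ M 𝓘, Comps B C A M 𝓘 := by
  set M := normalClosure (A : Set G) with hM
  have Mn : M.Normal := normalClosure_normal
  have AM : A ≤ M := subset_normalClosure
  have Mmin : ∀ N : Subgroup G, N.Normal → N ≠ ⊥ → M ≤ N := fun N hN hne =>
    normalClosure_le_normal (h.A_le_normal N hN hne)
  obtain ⟨a, ha, a', ha', haa⟩ := h.Anc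
  have Mcent' : centralizer (M : Set G) = ⊥ := by
    by_contra hne
    have := h.A_le_normal (centralizer (M : Set G)) inferInstance hne
    exact haa (mem_centralizer_iff.1 (this ha') a (AM ha))
  have Mcent : ∀ x, (∀ m ∈ M, x * m = m * x) → x = 1 := by
    intro x hx
    have : x ∈ centralizer (M : Set G) := mem_centralizer_iff.2 fun m hm => (hx m hm).symm
    rw [Mcent'] at this
    exact this
  have Mperf : M ≤ ⁅M, M⁆ := by
    apply Mmin _ inferInstance
    intro hb
    have : ⁅a, a'⁆ ∈ ⁅M, M⁆ := Subgroup.commutator_mem_commutator (AM ha) (AM ha')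
    rw [hb, Subgroup.mem_bot, commutatorElement_eq_one_iff_mul_comm] at this
    exact haa this
  have Mne : M ≠ ⊥ := fun hb => h.Ane (le_bot_iff.1 (hb ▸ AM))
  have MB : ¬ M ≤ B := fun hb => Mne (h.bcf M Mn hb)
  obtain ⟨S, ⟨hSne, hSM, hSn⟩, -, hSmin⟩ :=
    exists_min_subgroup (fun L : Subgroup G => L ≠ ⊥ ∧ L ≤ M ∧ Nz M L) M ⟨Mne, le_rfl, nz_of_normal Mn⟩
  set 𝓘 : Set (Subgroup G) := Set.range (fun g => cj g S) with h𝓘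
  have hconj : ∀ g, ∀ T ∈ 𝓘, cj g T ∈ 𝓘 := by
    rintro g _ ⟨x, rfl⟩
    exact ⟨g * x, cj_mul g x S⟩
  have hle : ∀ T ∈ 𝓘, T ≤ M := by
    rintro _ ⟨x, rfl⟩
    have := cj_mono (g := x) hSM
    rwa [cj_normal Mn] at this
  have hnor : ∀ T ∈ 𝓘, Nz M T := by
    rintro _ ⟨x, rfl⟩
    have := nz_cj x hSn
    rwa [cj_normal Mn] at this
  have hne : ∀ T ∈ 𝓘, T ≠ ⊥ := by
    rintro _ ⟨x, rfl⟩
    exact cj_ne_bot hSne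
  have hmin : ∀ T ∈ 𝓘, ∀ L : Subgroup G, L ≤ T → L ≠ ⊥ → Nz M L → L = T := by
    rintro _ ⟨x, rfl⟩ L hL hLne hLn
    have h1 : cj x⁻¹ L ≤ S := by rw [cj_le_iff, inv_inv]; exact hL
    have h2 := hSmin (cj x⁻¹ L) ⟨cj_ne_bot hLne, h1.trans hSM, by
      have := nz_cj x⁻¹ hLn
      rwa [cj_normal Mn] at this⟩ h1
    change L = cj x S
    rw [← h2, cj_cj_inv]
  have hcomm : ∀ T ∈ 𝓘, ∀ T' ∈ 𝓘, T ≠ T' → Cm T T' := by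
    intro T hT T' hT' hTT
    apply commutator_mem_inf ((hnor T' hT').mono (hle T hT)) ((hnor T hT).mono (hle T' hT'))
    by_contra hb
    have h1 := hmin T hT _ inf_le_left hb (nz_inf (hnor T hT) (hnor T' hT'))
    have h2 := hmin T' hT' _ inf_le_right hb (nz_inf (hnor T hT) (hnor T' hT'))
    exact hTT (h1.symm.trans h2)
  have hS𝓘 : S ∈ 𝓘 := ⟨1, cj_one S⟩
  have hsup : sSup 𝓘 = M := by
    apply le_antisymm (sSup_le hle)
    apply Mmin
    · refine ⟨fun n hn g => ?_⟩
      have : cj g (sSup 𝓘) ≤ sSup 𝓘 := by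
        rw [cj_sSup]
        apply sSup_le
        rintro _ ⟨T, hT, rfl⟩
        exact le_sSup (hconj g T hT)
      exact this (conj_mem_cj hn)
    · intro hb
      exact hSne (le_bot_iff.1 (hb ▸ le_sSup hS𝓘))
  have hsimp : ∀ T ∈ 𝓘, ∀ L : Subgroup G, L ≤ T → L ≠ ⊥ → Nz T L → L = T := by
    intro T hT L hL hLne hLn
    apply hmin T hT L hL hLne
    rw [← hsup]
    apply nz_sSup
    intro T' hT'
    by_cases hTT : T' = T
    · rw [hTT]; exact hLn
    · exact ((hcomm T' hT' T hT hTT).mono le_rfl hL).nz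
  have hnonab : ∀ T ∈ 𝓘, ∃ x ∈ T, ∃ y ∈ T, x * y ≠ y * x := by
    intro T hT
    by_contra hcon
    push Not at hcon
    have h1 : Cm M T := by
      rw [← hsup]
      apply cm_sSup
      intro T' hT'
      by_cases hTT : T' = T
      · rw [hTT]; exact hcon
      · exact hcomm T' hT' T hT hTT
    apply hne T hT
    rw [eq_bot_iff]
    intro t ht
    exact Mcent t fun m hm => (h1 m hm t ht).symm
  have htrans : ∀ T ∈ 𝓘, ∀ T' ∈ 𝓘, ∃ g, cj g T = T' := by
    rintro _ ⟨x, rfl⟩ _ ⟨y, rfl⟩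
    exact ⟨y * x⁻¹, by rw [← cj_mul]; simp⟩
  exact ⟨M, 𝓘, ⟨h, Mn, AM, Mmin, Mcent, Mperf, MB, hconj, hle, hnor, hne, hsimp, hcomm, hsup,
    hnonab, htrans, ⟨S, hS𝓘⟩⟩⟩

namespace Comps
variable {G : Type*} [Group G] {B C A M : Subgroup G} {𝓘 : Set (Subgroup G)}

lemma cm_of_disj (h : Comps B C A M 𝓘) {X Y : Set (Subgroup G)} (hX : X ⊆ 𝓘) (hY : Y ⊆ 𝓘)
    (hXY : ∀ T ∈ X, T ∉ Y) : Cm (sSup X) (sSup Y) := by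
  apply cm_sSup
  intro T hT
  apply Cm.symm
  apply cm_sSup
  intro T' hT'
  exact h.comm T' (hY hT') T (hX hT) (by rintro rfl; exact hXY _ hT hT')

lemma disj (h : Comps B C A M 𝓘) {X Y : Set (Subgroup G)} (hX : X ⊆ 𝓘) (hY : Y ⊆ 𝓘)
    (hXY : ∀ T ∈ X, T ∉ Y) {x : G} (hx : x ∈ sSup X) (hy : x ∈ sSup Y) : x = 1 := by
  apply h.Mcent
  have : Cm M (sSup X ⊓ sSup Y) := by
    rw [← h.sup]
    apply cm_sSup
    intro T hT
    by_cases hTX : T ∈ X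
    · exact (h.cm_of_disj hX hY hXY).mono (le_sSup hTX) inf_le_right
    · have h1 : Cm T (sSup X) := by
        apply Cm.symm
        apply cm_sSup
        intro T' hT'
        exact h.comm T' (hX hT') T hT (by rintro rfl; exact hTX hT')
      exact h1.mono le_rfl inf_le_left
  intro m hm
  exact (this m hm x ⟨hx, hy⟩).symm

lemma nor_sSup (h : Comps B C A M 𝓘) {X : Set (Subgroup G)} (hX : X ⊆ 𝓘) : Nz M (sSup X) :=
  nz_target_sSup fun T hT => h.nor T (hX hT)

lemma final (h : Comps B C A M 𝓘) (hone : ∀ T ∈ 𝓘, ∀ T' ∈ 𝓘, T = T') :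
    ∃ S : Subgroup G, S.Normal ∧ IsSimpleGroup ↥S ∧
      (∃ x ∈ S, ∃ y ∈ S, x * y ≠ y * x) ∧
      Subgroup.centralizer (S : Set G) = ⊥ := by
  obtain ⟨S, hS⟩ := h.nonemp
  have hSM : S = M := by
    rw [← h.sup]
    apply le_antisymm (le_sSup hS)
    exact sSup_le fun T hT => (hone T hT S hS).le
  subst hSM
  refine ⟨S, h.Mn, ?_, h.nonab S hS, ?_⟩
  · have hnt : Nontrivial S := (Subgroup.nontrivial_iff_ne_bot S).2 (h.ne S hS)
    refine ⟨fun H hH => ?_⟩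
    by_cases hb : H = ⊥
    · exact Or.inl hb
    right
    have := h.simp S hS (H.map S.subtype) (Subgroup.map_subtype_le H) (by
      rw [Ne, Subgroup.map_eq_bot_iff_of_injective H S.subtype_injective]; exact hb) (by
      rintro m hm _ ⟨x, hx, rfl⟩
      exact ⟨⟨m, hm⟩ * x * ⟨m, hm⟩⁻¹, hH.conj_mem x hx ⟨m, hm⟩, rfl⟩)
    apply Subgroup.map_injective S.subtype_injective
    rw [this, ← MonoidHom.range_eq_map, Subgroup.range_subtype]
  · rw [eq_bot_iff]
    intro x hx
    exact h.Mcent x fun m hm => (mem_centralizer_iff.1 hx m hm).symm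

end Comps
end MonoFact

namespace MonoFact
open Subgroup
open scoped commutatorElement

lemma wl_abs' {Λ I : Type*} [Finite Λ] [Finite I] (π : Λ → I) (f : Equiv.Perm Λ) (g : Equiv.Perm I)
    (hπ : ∀ x, π (f x) = g (π x)) (m : ℕ) (hm : 3 ≤ m) (hfib : ∀ i, Nat.card {x // π x = i} = m)
    (base : I → Λ)
    (htrans : ∀ ω : I → Λ, (∀ i, π (ω i) = i) →
      ∃ j : ℕ, ∀ i, ω ((g ^ j) i) = (f ^ j) (base i)) : Nat.card I ≤ 1 := by
  refine wl_abs π f g hπ m hm hfib ?_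
  intro ω ω' hω hω'
  obtain ⟨j, hj⟩ := htrans ω hω
  obtain ⟨j', hj'⟩ := htrans ω' hω'
  set n := orderOf f * orderOf g with hn
  have hn0 : 0 < n := Nat.mul_pos (orderOf_pos f) (orderOf_pos g)
  have hfn : f ^ n = 1 := by rw [hn, pow_mul, pow_orderOf_eq_one, one_pow]
  have hgn : g ^ n = 1 := by rw [hn, mul_comm, pow_mul, pow_orderOf_eq_one, one_pow]
  clear_value n
  have hle : j ≤ n * j := Nat.le_mul_of_pos_left j hn0
  refine ⟨j' + (n * j - j), fun i => ?_⟩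
  obtain ⟨i', rfl⟩ : ∃ i', i = (g ^ j) i' := ⟨(g ^ j)⁻¹ i, (perm_self_inv _ _).symm⟩
  have e : j' + (n * j - j) + j = j' + n * j := by omega
  rw [hj, ← Equiv.Perm.mul_apply, ← Equiv.Perm.mul_apply, ← pow_add, ← pow_add, e, pow_add, pow_add,
    pow_mul, pow_mul, hfn, hgn, one_pow, one_pow, mul_one, mul_one, hj']

lemma perm_solvable_small {X : Type*} [Finite X] (h : Nat.card X ≤ 2) :
    Group.IsSolvable (Equiv.Perm X) := by
  have hc : Nat.card (Equiv.Perm X) = (Nat.card X).factorial := Nat.card_perm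
  have hcyc : IsCyclic (Equiv.Perm X) := by
    interval_cases hx : Nat.card X
    · have : Subsingleton (Equiv.Perm X) := (Nat.card_eq_one_iff_unique.1 (by rw [hc]; rfl)).1
      infer_instance
    · have : Subsingleton (Equiv.Perm X) := (Nat.card_eq_one_iff_unique.1 (by rw [hc]; rfl)).1
      infer_instance
    · have : Fact (Nat.Prime 2) := ⟨Nat.prime_two⟩
      exact isCyclic_of_prime_card (p := 2) (by rw [hc]; rfl)
  let _ := hcyc.commGroup
  infer_instance

namespace Comps
variable {G : Type*} [Group G] {B C A M : Subgroup G} {𝓘 : Set (Subgroup G)}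

lemma comp_perf (h : Comps B C A M 𝓘) {T : Subgroup G} (hT : T ∈ 𝓘) : T ≤ ⁅T, T⁆ := by
  apply ge_of_eq
  apply h.simp T hT
  · exact Subgroup.commutator_le.2 fun a ha b hb =>
      T.mul_mem (T.mul_mem (T.mul_mem ha hb) (T.inv_mem ha)) (T.inv_mem hb)
  · intro hbot
    obtain ⟨a, ha, a', ha', hne⟩ := h.nonab T hT
    have : ⁅a, a'⁆ ∈ ⁅T, T⁆ := Subgroup.commutator_mem_commutator ha ha'
    rw [hbot, Subgroup.mem_bot, commutatorElement_eq_one_iff_mul_comm] at this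
    exact hne this
  · intro b hb n hn
    have : cj b ⁅T, T⁆ ≤ ⁅T, T⁆ := by
      unfold cj
      rw [Subgroup.map_commutator]
      have hm : Subgroup.map (MulAut.conj b).toMonoidHom T ≤ T := ((nz_self T).cj_eq hb).le
      exact Subgroup.commutator_mono hm hm
    exact this (conj_mem_cj hn)

lemma not_solvable (h : Comps B C A M 𝓘) {T K : Subgroup G} (hT : T ∈ 𝓘) (hTK : T ≤ K) :
    ¬ Group.IsSolvable K := by
  intro hs
  have := perfect_hom (perfect_coe T (h.comp_perf hT)) hs (Subgroup.inclusion hTK)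
  apply h.ne T hT
  rw [eq_bot_iff]
  intro x hx
  exact congrArg Subtype.val (this ⟨x, hx⟩)

lemma nz_B (_h : Comps B C A M 𝓘) {Y : Set (Subgroup G)}
    (hYB : ∀ b ∈ B, ∀ T ∈ Y, cj b T ∈ Y) : Nz B (sSup Y) := by
  intro b hb n hn
  have : cj b (sSup Y) ≤ sSup Y := by
    rw [cj_sSup]
    apply sSup_le
    rintro _ ⟨T, hT, rfl⟩
    exact le_sSup (hYB b hb T hT)
  exact this (conj_mem_cj hn)

lemma meets_Y (h : Comps B C A M 𝓘) {Y : Set (Subgroup G)} (hY : Y ⊆ 𝓘) (hYne : Y.Nonempty)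
    (hYB : ∀ b ∈ B, ∀ T ∈ Y, cj b T ∈ Y) : A ≤ sSup Y := by
  have hNz := h.nz_B hYB
  apply h.stp.A_le_of_meets _ hNz
  by_contra hcon
  push Not at hcon
  obtain ⟨T, hT⟩ := hYne
  apply h.not_solvable (hY hT) (le_sSup hT)
  refine solvable_of_inf_eq_bot B (sSup Y) (C ⊓ (sSup Y ⊔ B))
    (fun x hx y hy => h.stp.comm x hx.1 y hy.1) ?_ hcon ?_
  · intro d hd k hk
    exact nz_sup (nz_self _) hNz d hd.2 k hk
  · intro x hx
    obtain ⟨b, hb, c, hc, rfl⟩ := h.stp.fact x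
    refine ⟨b, hb, c, ⟨hc, ?_⟩, rfl⟩
    have h1 : b⁻¹ ∈ sSup Y ⊔ B := le_sup_right (a := sSup Y) (B.inv_mem hb)
    have h2 : b * c ∈ sSup Y ⊔ B := le_sup_left (a := sSup Y) hx
    simpa using mul_mem h1 h2

lemma Btrans (h : Comps B C A M 𝓘) : ∀ T ∈ 𝓘, ∀ T' ∈ 𝓘, ∃ b ∈ B, cj b T = T' := by
  intro T hT T' hT'
  by_contra hcon
  push Not at hcon
  set Y : Set (Subgroup G) := {T' | ∃ b ∈ B, cj b T = T'} with hY
  have hYI : Y ⊆ 𝓘 := by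
    rintro _ ⟨b, hb, rfl⟩; exact h.conj b T hT
  have hYB : ∀ b ∈ B, ∀ T ∈ Y, cj b T ∈ Y := by
    rintro b hb _ ⟨b', hb', rfl⟩
    exact ⟨b * b', B.mul_mem hb hb', cj_mul b b' T⟩
  have h1 := h.meets_Y hYI ⟨T, 1, B.one_mem, cj_one T⟩ hYB
  have h2 := h.meets_Y (Y := 𝓘 \ Y) Set.sdiff_subset ⟨T', hT', by rintro ⟨b, hb, e⟩; exact hcon b hb e⟩ (by
    rintro b hb T2 ⟨hT2, hT2'⟩
    refine ⟨h.conj b T2 hT2, fun hc => hT2' ?_⟩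
    have := hYB b⁻¹ (B.inv_mem hb) _ hc
    rwa [cj_inv_cj] at this)
  apply h.stp.Ane
  rw [eq_bot_iff]
  intro a ha
  exact h.disj hYI Set.sdiff_subset (fun T hT hT' => hT'.2 hT) (h1 ha) (h2 ha)

/-- the cyclic supplement -/
lemma exists_gen [Finite G] (h : Comps B C A M 𝓘) : ∃ d0 : G, d0 ∈ C ∧ d0 ∈ M ⊔ B ∧
    orderOf d0 = Nat.card (C ⊓ (M ⊔ B) : Subgroup G) ∧
    (∀ d ∈ C ⊓ (M ⊔ B), ∃ j : ℕ, d0 ^ j = d) ∧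
    ∀ x ∈ M ⊔ B, ∃ j : ℕ, ∃ b ∈ B, x = d0 ^ j * b := by
  have hDcyc : IsCyclic (C ⊓ (M ⊔ B) : Subgroup G) := by
    have := h.stp.cyc
    exact isCyclic_of_injective (Subgroup.inclusion (inf_le_left : C ⊓ (M ⊔ B) ≤ C))
      (Subgroup.inclusion_injective _)
  obtain ⟨⟨d0, hd0⟩, hgen⟩ := hDcyc.exists_generator
  have hgen' : ∀ d ∈ C ⊓ (M ⊔ B), ∃ j : ℕ, d0 ^ j = d := by
    intro d hd
    have := hgen ⟨d, hd⟩
    rw [← mem_powers_iff_mem_zpowers] at this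
    obtain ⟨j, hj⟩ := this
    exact ⟨j, congrArg Subtype.val hj⟩
  refine ⟨d0, hd0.1, hd0.2, ?_, hgen', ?_⟩
  · have := orderOf_eq_card_of_forall_mem_zpowers hgen
    rw [← this]
    exact (Subgroup.orderOf_mk d0 hd0).symm
  · intro x hx
    obtain ⟨c, hc, b, hb, rfl⟩ := h.stp.fact' x
    have hcD : c ∈ M ⊔ B := by
      have h1 : b⁻¹ ∈ M ⊔ B := le_sup_right (a := M) (B.inv_mem hb)
      have := mul_mem hx h1
      simpa using this
    obtain ⟨j, rfl⟩ := hgen' c ⟨hc, hcD⟩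
    exact ⟨j, b, hb, rfl⟩

end Comps
end MonoFact

namespace MonoFact
open Subgroup
open scoped commutatorElement

/-- finite Chinese remainder step -/
lemma crt {G : Type*} [Group G] (M R : Subgroup G) (𝓑 : Set (Subgroup G))
    (hle : ∀ b ∈ 𝓑, b ≤ M) (hcm : ∀ b ∈ 𝓑, ∀ b' ∈ 𝓑, b ≠ b' → Cm b b') (hsup : sSup 𝓑 = M)
    (x : Subgroup G → G) (hx : ∀ b ∈ 𝓑, x b ∈ M) (s : Finset (Subgroup G)) (hs : ∀ b ∈ s, b ∈ 𝓑) :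
    ∃ m ∈ M, ∀ b ∈ s, m⁻¹ * x b ∈ R ⊔ sSup (𝓑 \ {b}) := by
  classical
  induction s using Finset.induction with
  | empty => exact ⟨1, M.one_mem, by simp⟩
  | insert c s hc ih =>
    obtain ⟨m, hm, hmb⟩ := ih (fun b hb => hs b (Finset.mem_insert_of_mem hb))
    have hc𝓑 : c ∈ 𝓑 := hs c (Finset.mem_insert_self c s)
    have hM : M ≤ c ⊔ sSup (𝓑 \ {c}) := by
      rw [← hsup]
      apply sSup_le
      intro b hb
      by_cases hbc : b = c
      · rw [hbc]; exact le_sup_left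
      · have hmem : b ∈ 𝓑 \ {c} := ⟨hb, hbc⟩
        exact le_trans (le_sSup hmem) le_sup_right
    have hNz : Nz (sSup (𝓑 \ {c})) c := by
      apply nz_sSup
      intro b hb
      exact (hcm b hb.1 c hc𝓑 hb.2).nz
    obtain ⟨t, ht, r, hr, e⟩ := (mem_sup_nz hNz).1 (hM (M.mul_mem (M.inv_mem hm) (hx c hc𝓑)))
    refine ⟨m * t, M.mul_mem hm (hle c hc𝓑 ht), ?_⟩
    intro b hb
    rw [mul_inv_rev, mul_assoc]
    rcases Finset.mem_insert.1 hb with rfl | hb'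
    · rw [e]
      simpa using le_sup_right (a := R) hr
    · refine mul_mem ?_ (hmb b hb')
      apply le_sup_right (a := R)
      have hmem : c ∈ 𝓑 \ {b} := ⟨hc𝓑, by rintro rfl; exact hc hb'⟩
      exact le_sSup hmem (c.inv_mem ht)

namespace Comps
variable {G : Type*} [Group G] {B C A M : Subgroup G} {𝓘 : Set (Subgroup G)}

lemma wl [Finite G] (h : Comps B C A M 𝓘) (𝓑 : Set (Subgroup G))
    (hle : ∀ b ∈ 𝓑, b ≤ M) (hnor : ∀ b ∈ 𝓑, Nz M b)
    (hcm : ∀ b ∈ 𝓑, ∀ b' ∈ 𝓑, b ≠ b' → Cm b b') (hsup : sSup 𝓑 = M)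
    (hB : ∀ y ∈ B, ∀ b ∈ 𝓑, cj y b ∈ 𝓑) (htr : ∀ b ∈ 𝓑, ∀ b' ∈ 𝓑, ∃ y ∈ B, cj y b = b')
    (b0 : Subgroup G) (hb0 : b0 ∈ 𝓑) (hW : (M ⊓ B) ⊔ sSup (𝓑 \ {b0}) ≠ M) :
    ∀ b ∈ 𝓑, b = b0 := by
  classical
  obtain ⟨d0, hd0C, hd0Γ, -, -, hΓ⟩ := h.exists_gen
  set Γ := M ⊔ B with hΓdef
  have hMΓ : M ≤ Γ := le_sup_left
  have hBΓ : B ≤ Γ := le_sup_right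
  have hΓMB : ∀ x ∈ Γ, ∃ m ∈ M, ∃ y ∈ B, x = m * y := fun x hx => (mem_sup_normal h.Mn).1 hx
  have hΓ𝓑 : ∀ x ∈ Γ, ∀ b ∈ 𝓑, cj x b ∈ 𝓑 := by
    intro x hx b hb
    obtain ⟨m, hm, y, hy, rfl⟩ := hΓMB x hx
    rw [cj_mul, (hnor _ (hB y hy b hb)).cj_eq hm]
    exact hB y hy b hb
  set W := (M ⊓ B) ⊔ sSup (𝓑 \ {b0}) with hWdef
  have hWM : W ≤ M := sup_le inf_le_left (sSup_le fun b hb => hle b hb.1)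
  let N : Subgroup G :=
    { carrier := {y | y ∈ B ∧ cj y b0 = b0}
      one_mem' := ⟨B.one_mem, cj_one b0⟩
      mul_mem' := by
        rintro a b ⟨ha, ha'⟩ ⟨hb, hb'⟩
        exact ⟨B.mul_mem ha hb, by rw [cj_mul, hb', ha']⟩
      inv_mem' := by
        rintro a ⟨ha, ha'⟩
        refine ⟨B.inv_mem ha, ?_⟩
        conv_lhs => rw [← ha']
        rw [cj_inv_cj] }
  have hN : ∀ y, y ∈ N ↔ y ∈ B ∧ cj y b0 = b0 := fun y => Iff.rfl
  -- conjugation by B on the W's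
  have hWcj : ∀ y ∈ B, ∀ b ∈ 𝓑, cj y ((M ⊓ B) ⊔ sSup (𝓑 \ {b})) ≤ (M ⊓ B) ⊔ sSup (𝓑 \ {cj y b}) := by
    intro y hy b hb
    rw [cj_le_iff]
    apply sup_le
    · rw [← cj_le_iff]
      refine le_trans ?_ le_sup_left
      intro x hx
      rw [mem_cj] at hx
      have h1 := h.Mn.conj_mem _ hx.1 y
      have h2 := B.mul_mem (B.mul_mem hy hx.2) (B.inv_mem hy)
      have e : y * (y⁻¹ * x * y) * y⁻¹ = x := by group
      rw [e] at h1 h2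
      exact ⟨h1, h2⟩
    · apply sSup_le
      intro b' hb'
      rw [← cj_le_iff]
      refine le_trans (le_sSup ?_) le_sup_right
      exact ⟨hB y hy b' hb'.1, fun hc => hb'.2 (cj_inj.1 hc)⟩
  have hNW : Nz N W := by
    intro y hy w hw
    have := hWcj y hy.1 b0 hb0 (conj_mem_cj hw)
    rwa [hy.2] at this
  set P := W ⊔ N with hP
  have hPΓ : P ≤ Γ := sup_le (hWM.trans hMΓ) (fun y hy => hBΓ hy.1)
  have hPM : ∀ x ∈ P, x ∈ M → x ∈ W := by
    intro x hx hxM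
    obtain ⟨w, hw, n, hn, rfl⟩ := (mem_sup_nz hNW).1 hx
    apply W.mul_mem hw
    have : n ∈ M := by simpa using M.mul_mem (M.inv_mem (hWM hw)) hxM
    exact le_sup_left (a := M ⊓ B) ⟨this, hn.1⟩
  have hPb0 : ∀ x ∈ P, cj x b0 = b0 := by
    intro x hx
    obtain ⟨w, hw, n, hn, rfl⟩ := (mem_sup_nz hNW).1 hx
    rw [cj_mul, hn.2, (hnor b0 hb0).cj_eq (hWM hw)]
  have hNP : ∀ y ∈ B, cj y b0 = b0 → y ∈ P := fun y hy hy' => le_sup_right (a := W) ⟨hy, hy'⟩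
  -- the set of cosets
  let Λ := {q : G ⧸ P // ∃ x ∈ Γ, q = (x : G ⧸ P)}
  let mk : (x : G) → x ∈ Γ → Λ := fun x hx => ⟨(x : G ⧸ P), x, hx, rfl⟩
  have hmk : ∀ l : Λ, ∃ x, ∃ hx : x ∈ Γ, l = mk x hx := by
    rintro ⟨q, x, hx, rfl⟩; exact ⟨x, hx, rfl⟩
  have hmkeq : ∀ x hx y hy, mk x hx = mk y hy ↔ x⁻¹ * y ∈ P := by
    intro x hx y hy
    rw [← QuotientGroup.eq]
    exact Subtype.ext_iff
  have hout : ∀ x : G, cj ((x : G ⧸ P).out) b0 = cj x b0 := by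
    intro x
    have h1 : ((x : G ⧸ P).out)⁻¹ * x ∈ P := by
      rw [← QuotientGroup.eq]; simp
    have h2 := hPb0 _ h1
    conv_lhs => rw [← h2]
    rw [← cj_mul]; simp
  let π : Λ → 𝓑 := fun l => ⟨cj (l.1.out) b0, by
    obtain ⟨x, hx, e⟩ := l.2
    rw [e, hout]
    exact hΓ𝓑 x hx b0 hb0⟩
  have hπmk : ∀ x hx, (π (mk x hx)).1 = cj x b0 := fun x hx => hout x
  -- action of Γ on Λ and 𝓑
  let act : Γ →* Equiv.Perm Λ :=
    MonoidHom.toHomPerm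
    { toFun := fun γ l => ⟨(γ : G) • l.1, by
        obtain ⟨x, hx, e⟩ := l.2
        exact ⟨γ * x, Γ.mul_mem γ.2 hx, by rw [e]; rfl⟩⟩
      map_one' := by funext l; exact Subtype.ext (one_smul G l.1)
      map_mul' := fun a b => by funext l; exact Subtype.ext (mul_smul (a : G) (b : G) l.1) }
  have hact : ∀ (γ : Γ) x hx, act γ (mk x hx) = mk (γ * x) (Γ.mul_mem γ.2 hx) := fun γ x hx => rfl
  let act2 : Γ →* Equiv.Perm 𝓑 :=
    MonoidHom.toHomPerm
    { toFun := fun γ b => ⟨cj (γ : G) b.1, hΓ𝓑 γ γ.2 b.1 b.2⟩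
      map_one' := by funext l; exact Subtype.ext (cj_one l.1)
      map_mul' := fun a b => by funext l; exact Subtype.ext (cj_mul (a : G) (b : G) l.1) }
  have hact2 : ∀ (γ : Γ) b, (act2 γ b).1 = cj (γ : G) b.1 := fun γ b => rfl
  have hπact : ∀ γ l, π (act γ l) = act2 γ (π l) := by
    intro γ l
    obtain ⟨x, hx, rfl⟩ := hmk l
    apply Subtype.ext
    rw [hact γ x hx, hact2, hπmk _ (Γ.mul_mem γ.2 hx), hπmk x hx, cj_mul]
  have hfinΛ : Finite Λ := inferInstance
  have hfin𝓑 : Finite 𝓑 := inferInstance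
  set i0 : 𝓑 := ⟨b0, hb0⟩ with hi0
  set m := Nat.card {l // π l = i0} with hm
  have hfib : ∀ i, Nat.card {l // π l = i} = m := by
    rintro ⟨b, hb⟩
    obtain ⟨y, hy, e⟩ := htr b0 hb0 b hb
    rw [hm]
    symm
    refine Nat.card_congr (Equiv.subtypeEquiv (act ⟨y, hBΓ hy⟩) ?_)
    intro l
    rw [hπact]
    have : (⟨b, hb⟩ : 𝓑) = act2 ⟨y, hBΓ hy⟩ i0 := Subtype.ext e.symm
    rw [this, EmbeddingLike.apply_eq_iff_eq]
  have hact2M : ∀ (x : G) (hx : x ∈ M) i, act2 ⟨x, hMΓ hx⟩ i = i := by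
    intro x hx i
    apply Subtype.ext
    rw [hact2]
    exact (hnor i.1 i.2).cj_eq hx
  have hm3 : 3 ≤ m := by
    by_contra hlt
    have hs := perm_solvable_small (X := {l // π l = i0}) (by omega)
    let φ : M →* Equiv.Perm {l // π l = i0} :=
      MonoidHom.toHomPerm
      { toFun := fun x l => ⟨act ⟨x, hMΓ x.2⟩ l.1, by rw [hπact, hact2M x.1 x.2, l.2]⟩
        map_one' := by
          funext l
          apply Subtype.ext
          change act 1 l.1 = l.1
          rw [map_one]; rfl
        map_mul' := fun a b => by
          funext l
          apply Subtype.ext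
          change act (⟨a, hMΓ a.2⟩ * ⟨b, hMΓ b.2⟩) l.1 = _
          rw [map_mul]; rfl }
    apply hW
    apply le_antisymm hWM
    intro x hx
    have h1 := perfect_hom (perfect_coe M h.Mperf) hs φ ⟨x, hx⟩
    have hb : π (mk 1 Γ.one_mem) = i0 := Subtype.ext (by rw [hπmk 1 Γ.one_mem, cj_one])
    have h2 := congrArg Subtype.val (DFunLike.congr_fun h1 ⟨mk 1 Γ.one_mem, hb⟩)
    have h3 : mk (x * 1) (Γ.mul_mem (hMΓ hx) Γ.one_mem) = mk 1 Γ.one_mem := h2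
    replace h3 := (hmkeq (x * 1) (Γ.mul_mem (hMΓ hx) Γ.one_mem) 1 Γ.one_mem).1 h3
    apply hPM x _ hx
    have := P.inv_mem h3
    simpa using this
  -- base section
  have hy : ∀ i : 𝓑, ∃ y ∈ B, cj y b0 = i.1 := fun i => htr b0 hb0 i.1 i.2
  choose y hyB hyb using hy
  let base : 𝓑 → Λ := fun i => mk (y i) (hBΓ (hyB i))
  have hbase : ∀ z (hz : z ∈ B) (i : 𝓑), cj z b0 = i.1 → mk z (hBΓ hz) = base i := by
    intro z hz i e
    refine (hmkeq _ (hBΓ hz) _ (hBΓ (hyB i))).2 ?_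
    apply hNP _ (B.mul_mem (B.inv_mem hz) (hyB i))
    rw [cj_mul, hyb, ← e, cj_inv_cj]
  have hcard := wl_abs' π (act ⟨d0, hd0Γ⟩) (act2 ⟨d0, hd0Γ⟩) (hπact _) m hm3 hfib base ?_
  · intro b hb
    have : Subsingleton 𝓑 := Finite.card_le_one_iff_subsingleton.1 hcard
    exact congrArg Subtype.val (Subsingleton.elim (⟨b, hb⟩ : 𝓑) i0)
  intro ω hω
  -- ω b = x_b • base b
  have hx : ∀ i : 𝓑, ∃ x, ∃ hx : x ∈ M, ω i = act ⟨x, hMΓ hx⟩ (base i) := by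
    intro i
    obtain ⟨z, hz, e⟩ := hmk (ω i)
    obtain ⟨x, hx, u, hu, rfl⟩ := hΓMB z hz
    refine ⟨x, hx, ?_⟩
    have h1 : cj u b0 = i.1 := by
      have := hω i
      rw [e] at this
      have h2 := congrArg Subtype.val this
      rw [hπmk _ hz, cj_mul, (hnor _ (hB u hu b0 hb0)).cj_eq hx] at h2
      exact h2
    rw [← hbase u hu i h1, e]
    rfl
  choose x hxM hωx using hx
  let x' : Subgroup G → G := fun b => if hb : b ∈ 𝓑 then x ⟨b, hb⟩ else 1
  obtain ⟨μ, hμ, hμb⟩ := crt M (M ⊓ B) 𝓑 hle hcm hsup x' (by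
    intro b hb
    simp only [x', hb, dif_pos]
    exact hxM _) (Set.toFinite 𝓑).toFinset (by intro b hb; simpa using hb)
  have hωμ : ∀ i, ω i = act ⟨μ, hMΓ hμ⟩ (base i) := by
    intro i
    have h1 := hμb i.1 (by simp)
    have h2 : x' i.1 = x i := by
      simp only [x', i.2, dif_pos]
    rw [h2] at h1
    rw [hωx]
    change mk (x i * y i) (Γ.mul_mem (hMΓ (hxM i)) (hBΓ (hyB i))) = mk (μ * y i) (Γ.mul_mem (hMΓ hμ) (hBΓ (hyB i)))
    symm
    refine (hmkeq _ (Γ.mul_mem (hMΓ hμ) (hBΓ (hyB i))) _ (Γ.mul_mem (hMΓ (hxM i)) (hBΓ (hyB i)))).2 ?_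
    apply le_sup_left (a := W)
    have h3 := hWcj (y i)⁻¹ (B.inv_mem (hyB i)) i.1 i.2 (conj_mem_cj h1)
    have e : cj (y i)⁻¹ i.1 = b0 := by rw [← hyb i, cj_inv_cj]
    rw [e] at h3
    rw [hWdef]
    convert h3 using 1
    group
  obtain ⟨j, u, hu, e⟩ := hΓ μ (hMΓ hμ)
  refine ⟨j, fun i => ?_⟩
  -- i = cj u i'
  set i' : 𝓑 := act2 ⟨u, hBΓ hu⟩⁻¹ i with hi'
  have hii : i = act2 ⟨u, hBΓ hu⟩ i' := by
    rw [hi', ← Equiv.Perm.mul_apply, ← map_mul, mul_inv_cancel, map_one]; rfl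
  have hμe : (⟨μ, hMΓ hμ⟩ : Γ) = ⟨d0, hd0Γ⟩ ^ j * ⟨u, hBΓ hu⟩ := Subtype.ext e
  have h1 : ((act2 ⟨d0, hd0Γ⟩) ^ j) i = i' := by
    rw [hii, ← Equiv.Perm.mul_apply, ← map_pow, ← map_mul, ← hμe, hact2M μ hμ]
  rw [h1, hωμ, hμe, map_mul, map_pow, Equiv.Perm.mul_apply]
  refine congrArg (⇑((act ⟨d0, hd0Γ⟩) ^ j)) ?_
  change mk (u * y i') (Γ.mul_mem (hBΓ hu) (hBΓ (hyB i'))) = _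
  apply hbase (u * y i') (B.mul_mem hu (hyB i'))
  rw [cj_mul, hyb, hii]
  rfl

end Comps
end MonoFact

namespace MonoFact
open Subgroup
open scoped commutatorElement
namespace Comps
variable {G : Type*} [Group G] {B C A M : Subgroup G} {𝓘 : Set (Subgroup G)}

lemma cm_of_inf_bot {T L : Subgroup G} (h : Nz T L) (h' : Nz L T) (hb : L ⊓ T = ⊥) : Cm L T := by
  intro l hl t ht
  have h1 : l * t * l⁻¹ * t⁻¹ ∈ T := T.mul_mem (h' l hl t ht) (T.inv_mem ht)
  have h2 : l * t * l⁻¹ * t⁻¹ ∈ L := by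
    have := L.mul_mem hl (h t ht _ (L.inv_mem hl))
    convert this using 1; group
  have h3 : l * t * l⁻¹ * t⁻¹ ∈ L ⊓ T := ⟨h2, h1⟩
  rw [hb, mem_bot] at h3
  have : l * t = (l * t * l⁻¹ * t⁻¹) * (t * l) := by group
  rw [this, h3, one_mul]

lemma cm_compl (h : Comps B C A M 𝓘) {T : Subgroup G} (hT : T ∈ 𝓘) : Cm (sSup (𝓘 \ {T})) T :=
  cm_sSup fun T' hT' => h.comm T' hT'.1 T hT hT'.2

lemma compl_disj (h : Comps B C A M 𝓘) {T : Subgroup G} (hT : T ∈ 𝓘) {x : G}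
    (hx : x ∈ sSup (𝓘 \ {T})) (hx' : x ∈ T) : x = 1 := by
  refine h.disj (X := 𝓘 \ {T}) (Y := {T}) (fun _ h => h.1) (by simpa using hT) (fun T' h => h.2) hx ?_
  simpa using hx'

lemma T_le_of_supp (h : Comps B C A M 𝓘) {T L : Subgroup G} (hT : T ∈ 𝓘)
    (hfull : (M ⊓ B) ⊔ sSup (𝓘 \ {T}) = M) (hL : L ≤ M ⊓ B) (hLn : Nz (M ⊓ B) L) (hs : ¬ Cm L T) :
    T ≤ L ⊔ sSup (𝓘 \ {T}) := by
  set K := sSup (𝓘 \ {T}) with hK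
  have hKn : Nz M K := h.nor_sSup (fun _ h => h.1)
  have hKM : K ≤ M := sSup_le fun T' h' => h.le T' h'.1
  have h1 : Nz (M ⊓ B) (L ⊔ K) := by
    have := nz_target_sSup (M := M ⊓ B) (X := {L, K}) (by
      intro X hX
      rcases hX with rfl | rfl
      · exact hLn
      · exact hKn.mono inf_le_left)
    rwa [sSup_pair] at this
  have h2 : Nz M (L ⊔ K) := by
    rw [← hfull]
    exact nz_sup h1 ((nz_self _).mono le_sup_right)
  have h3 : Nz M ((L ⊔ K) ⊓ T) := nz_inf h2 (h.nor T hT)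
  have hLM : L ⊔ K ≤ M := sup_le (hL.trans inf_le_left) hKM
  have hne : (L ⊔ K) ⊓ T ≠ ⊥ := by
    intro hb
    exact hs ((cm_of_inf_bot (h2.mono (h.le T hT)) ((h.nor T hT).mono hLM) hb).mono le_sup_left le_rfl)
  have := h.simp T hT _ inf_le_right hne (h3.mono (h.le T hT))
  rw [← this]
  exact inf_le_left

lemma supp_disj (h : Comps B C A M 𝓘) {T L L' : Subgroup G} (hT : T ∈ 𝓘)
    (hfull : (M ⊓ B) ⊔ sSup (𝓘 \ {T}) = M) (hL : L ≤ M ⊓ B) (hLn : Nz (M ⊓ B) L)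
    (hL' : L' ≤ M ⊓ B) (hLn' : Nz (M ⊓ B) L') (hcm : Cm L L') (hs : ¬ Cm L T) : Cm L' T := by
  by_contra hs'
  have h1 := h.T_le_of_supp hT hfull hL hLn hs
  have h2 := h.T_le_of_supp hT hfull hL' hLn' hs'
  set K := sSup (𝓘 \ {T}) with hK
  have hKn : Nz M K := h.nor_sSup (fun _ h => h.1)
  obtain ⟨x, hx, y, hy, hxy⟩ := h.nonab T hT
  apply hxy
  obtain ⟨l, hl, c, hc, ex⟩ := (mem_sup_nz' (hKn.mono (hL.trans inf_le_left))).1 (by rw [sup_comm]; exact h1 hx)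
  obtain ⟨l', hl', c', hc', ey⟩ := (mem_sup_nz' (hKn.mono (hL'.trans inf_le_left))).1 (by rw [sup_comm]; exact h2 hy)
  have hxy1 : y * x * y⁻¹ = x * (c⁻¹ * (l' * c * l'⁻¹)) := by
    have e1 : c' * x = x * c' := h.cm_compl hT c' hc' x hx
    have e2 : l * l' = l' * l := hcm l hl l' hl'
    calc y * x * y⁻¹ = l' * (c' * x) * c'⁻¹ * l'⁻¹ := by rw [ey]; group
      _ = l' * x * l'⁻¹ := by rw [e1]; group
      _ = (l' * l) * c * l'⁻¹ := by rw [ex]; group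
      _ = x * (c⁻¹ * (l' * c * l'⁻¹)) := by rw [← e2, ex]; group
  have hk : c⁻¹ * (l' * c * l'⁻¹) ∈ K :=
    K.mul_mem (K.inv_mem hc) (hKn l' (hL' hl').1 c hc)
  have ht : c⁻¹ * (l' * c * l'⁻¹) ∈ T := by
    have : c⁻¹ * (l' * c * l'⁻¹) = x⁻¹ * (y * x * y⁻¹) := by rw [hxy1]; group
    rw [this]
    exact T.mul_mem (T.inv_mem hx) (T.mul_mem (T.mul_mem hy hx) (T.inv_mem hy))
  rw [h.compl_disj hT hk ht, mul_one] at hxy1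
  rw [mul_inv_eq_iff_eq_mul] at hxy1
  exact hxy1.symm

/-- step (ii) -/
lemma diag [Finite G] (h : Comps B C A M 𝓘)
    (hfull : ∀ T ∈ 𝓘, (M ⊓ B) ⊔ sSup (𝓘 \ {T}) = M) : ∀ T ∈ 𝓘, ∀ x, x ∈ M → x ∈ B → x ∈ sSup (𝓘 \ {T}) → x = 1 := by
  -- every minimal L has full support
  have key : ∀ L : Subgroup G, (L ≤ M ⊓ B ∧ L ≠ ⊥ ∧ Nz (M ⊓ B) L) →
      (∀ L', (L' ≤ M ⊓ B ∧ L' ≠ ⊥ ∧ Nz (M ⊓ B) L') → L' ≤ L → L' = L) → ∀ T ∈ 𝓘, ¬ Cm L T := by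
    rintro L ⟨hL, hLne, hLn⟩ hmin
    set S := {T | T ∈ 𝓘 ∧ ¬ Cm L T} with hS
    have hRcj : ∀ y ∈ B, cj y (M ⊓ B) = M ⊓ B := by
      intro y hy
      refine Nz.cj_eq (M := B) ?_ hy
      exact nz_inf (nz_of_normal h.Mn) (nz_self B)
    have hcjL : ∀ y ∈ B, cj y L ≤ M ⊓ B ∧ Nz (M ⊓ B) (cj y L) := by
      intro y hy
      refine ⟨?_, ?_⟩
      · rw [← hRcj y hy]; exact cj_mono hL
      · have := nz_cj y hLn
        rwa [hRcj y hy] at this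
    have hcomm : ∀ y ∈ B, cj y L ≠ L → Cm L (cj y L) := by
      intro y hy hne
      refine cm_of_inf_bot (T := cj y L) (L := L) (hLn.mono (hcjL y hy).1) ((hcjL y hy).2.mono hL) ?_
      by_contra hb
      have h1 := hmin (L ⊓ cj y L) ⟨(inf_le_left : L ⊓ cj y L ≤ L).trans hL, hb, nz_inf hLn (hcjL y hy).2⟩ inf_le_left
      have h2 : L ≤ cj y L := inf_eq_left.1 h1
      have h3 : cj y⁻¹ L ≤ L := by rw [cj_le_iff, inv_inv]; exact h2
      have h4 := hmin (cj y⁻¹ L) ⟨(hcjL _ (B.inv_mem hy)).1, cj_ne_bot hLne, (hcjL _ (B.inv_mem hy)).2⟩ h3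
      apply hne
      conv_lhs => rw [← h4]
      rw [cj_cj_inv]
    have hcmcj : ∀ y T, Cm (cj y L) (cj y T) ↔ Cm L T := by
      intro y T
      refine ⟨fun hc => ?_, cj_cm y⟩
      have := cj_cm y⁻¹ hc
      rwa [cj_inv_cj, cj_inv_cj] at this
    have himg : ∀ y T, T ∈ cj y '' S ↔ T ∈ 𝓘 ∧ ¬ Cm (cj y L) T := by
      intro y T
      constructor
      · rintro ⟨T', ⟨hT', hs⟩, rfl⟩
        exact ⟨h.conj y T' hT', fun hc => hs ((hcmcj y T').1 hc)⟩
      · rintro ⟨hT, hs⟩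
        refine ⟨cj y⁻¹ T, ⟨h.conj _ T hT, fun hc => hs ?_⟩, cj_cj_inv y T⟩
        have := (hcmcj y (cj y⁻¹ T)).2 hc
        rwa [cj_cj_inv] at this
    have hSI : S ⊆ 𝓘 := fun T hT => hT.1
    have himgI : ∀ y, cj y '' S ⊆ 𝓘 := fun y T hT => ((himg y T).1 hT).1
    have hdisj : ∀ y ∈ B, cj y L ≠ L → ∀ T ∈ S, T ∉ cj y '' S := by
      intro y hy hne T hT hT'
      exact ((himg y T).1 hT').2 (h.supp_disj hT.1 (hfull T hT.1) hL hLn (hcjL y hy).1 (hcjL y hy).2 (hcomm y hy hne) hT.2)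
    have hSne : S.Nonempty := by
      by_contra hempty
      apply hLne
      rw [eq_bot_iff]
      intro x hx
      rw [mem_bot]
      apply h.Mcent
      have : Cm M L := by
        rw [← h.sup]
        apply cm_sSup
        intro T hT
        by_contra hc
        exact hempty ⟨T, hT, fun h' => hc h'.symm⟩
      intro m hm
      exact (this m hm x hx).symm
    set 𝓑 : Set (Subgroup G) := {b | ∃ y ∈ B, b = cj y (sSup S)} with h𝓑
    have hb0 : sSup S ∈ 𝓑 := ⟨1, B.one_mem, (cj_one _).symm⟩
    have hBcj : ∀ y ∈ B, ∀ b ∈ 𝓑, cj y b ∈ 𝓑 := by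
      rintro y hy b ⟨z, hz, rfl⟩
      exact ⟨y * z, B.mul_mem hy hz, (cj_mul _ _ _).symm⟩
    have hcj0 : ∀ y ∈ B, cj y L = L → cj y (sSup S) = sSup S := by
      intro y hy e
      rw [cj_sSup]
      congr 1
      ext T
      rw [himg, e]; rfl
    have hsup : sSup 𝓑 = M := by
      apply le_antisymm
      · apply sSup_le
        rintro b ⟨y, hy, rfl⟩
        rw [cj_sSup]
        exact sSup_le fun T hT => h.le T (himgI y hT)
      · rw [← h.sup]
        apply sSup_le
        intro T hT
        obtain ⟨T0, hT0⟩ := hSne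
        obtain ⟨y, hy, e⟩ := h.Btrans T0 hT0.1 T hT
        rw [← e]
        have hmem : cj y (sSup S) ∈ 𝓑 := ⟨y, hy, rfl⟩
        exact le_trans (cj_mono (le_sSup hT0)) (le_sSup hmem)
    have hone := h.wl 𝓑 ?_ ?_ ?_ hsup hBcj ?_ (sSup S) hb0 ?_
    · intro T hT
      obtain ⟨T0, hT0⟩ := hSne
      obtain ⟨y, hy, e⟩ := h.Btrans T0 hT0.1 T hT
      have h1 := hone (cj y (sSup S)) ⟨y, hy, rfl⟩
      have h2 : T ≤ sSup S := by
        rw [← h1, ← e]; exact cj_mono (le_sSup hT0)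
      by_contra hc
      apply h.ne T hT
      rw [eq_bot_iff]
      intro x hx
      refine h.disj (X := S) (Y := {T}) hSI (by simpa using hT) ?_ (h2 hx) (by simpa using hx)
      rintro T' hT' rfl
      exact hT'.2 hc
    · rintro b ⟨y, hy, rfl⟩
      rw [← cj_normal (g := y) h.Mn]
      exact cj_mono (sSup_le fun T hT => h.le T hT.1)
    · rintro b ⟨y, hy, rfl⟩
      rw [← cj_normal (g := y) h.Mn]
      exact nz_cj y (h.nor_sSup hSI)
    · have aux : ∀ y ∈ B, cj y (sSup S) ≠ sSup S → Cm (sSup S) (cj y (sSup S)) := by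
        intro y hy hne
        rw [cj_sSup]
        exact h.cm_of_disj hSI (himgI y) (hdisj y hy (fun e => hne (hcj0 y hy e)))
      rintro b ⟨y, hy, rfl⟩ b' ⟨y', hy', rfl⟩ hne
      have h1 := aux (y⁻¹ * y') (B.mul_mem (B.inv_mem hy) hy') (by
        intro e
        apply hne
        conv_lhs => rw [← e]
        rw [← cj_mul]; simp)
      have h2 := cj_cm y h1
      rw [← cj_mul] at h2
      simpa using h2
    · rintro b ⟨y, hy, rfl⟩ b' ⟨y', hy', rfl⟩
      refine ⟨y' * y⁻¹, B.mul_mem hy' (B.inv_mem hy), ?_⟩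
      rw [← cj_mul]; simp
    · intro hW
      have h1 : Cm (sSup (𝓑 \ {sSup S})) L := by
        apply cm_sSup
        rintro b ⟨⟨y, hy, rfl⟩, hb⟩
        rw [cj_sSup]
        apply cm_sSup
        intro T hT
        by_contra hc
        have hTS : T ∈ S := ⟨himgI y hT, fun h' => hc h'.symm⟩
        exact hdisj y hy (fun e => hb (hcj0 y hy e)) T hTS hT
      have h2 : Nz M L := by
        rw [← hW]; exact nz_sup hLn h1.nz
      obtain ⟨T, hT⟩ := hSne
      have h3 : L ⊓ T = T := by
        refine h.simp T hT.1 _ inf_le_right ?_ ((nz_inf h2 (h.nor T hT.1)).mono (h.le T hT.1))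
        intro hb
        exact hT.2 (cm_of_inf_bot (h2.mono (h.le T hT.1)) ((h.nor T hT.1).mono (hL.trans inf_le_left)) hb)
      have h4 : T ≤ B := by
        rw [← h3]; exact inf_le_left.trans (hL.trans inf_le_right)
      apply h.MB
      rw [← h.sup]
      apply sSup_le
      intro T' hT'
      obtain ⟨y, hy, rfl⟩ := h.Btrans T hT.1 T' hT'
      rw [← (nz_self B).cj_eq hy]
      exact cj_mono h4
  intro T hT x hxM hxB hxK
  by_contra hx1
  set N := (M ⊓ B) ⊓ sSup (𝓘 \ {T}) with hN
  have hPN : N ≤ M ⊓ B ∧ N ≠ ⊥ ∧ Nz (M ⊓ B) N := by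
    refine ⟨inf_le_left, ?_, nz_inf (nz_self _) ((h.nor_sSup (fun _ h => h.1)).mono inf_le_left)⟩
    intro e
    have : x ∈ N := ⟨⟨hxM, hxB⟩, hxK⟩
    rw [e, mem_bot] at this
    exact hx1 this
  obtain ⟨L, hPL, hLN, hmin⟩ := exists_min_subgroup (fun L => L ≤ M ⊓ B ∧ L ≠ ⊥ ∧ Nz (M ⊓ B) L) N hPN
  exact key L hPL hmin T hT ((h.cm_compl hT).mono (hLN.trans inf_le_right) le_rfl)

end Comps
end MonoFact

namespace MonoFact
open Subgroup
open scoped commutatorElement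

lemma card_simple_ge {S : Type*} [Group S] [Finite S] [IsSimpleGroup S]
    (hnc : ∃ x y : S, x * y ≠ y * x) : 9 ≤ Nat.card S := by
  obtain ⟨x, y, hxy⟩ := hnc
  have hpp : ∀ p k : ℕ, p.Prime → Nat.card S ≠ p ^ k := by
    intro p k hp e
    have : Fact p.Prime := ⟨hp⟩
    have hnt := (IsPGroup.of_card e).center_nontrivial
    rcases IsSimpleGroup.eq_bot_or_eq_top_of_normal (center S) inferInstance with hb | hb
    · rw [hb] at hnt
      exact not_nontrivial _ hnt
    · have : x ∈ center S := by rw [hb]; trivial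
      exact hxy ((mem_center_iff.1 this y).symm)
  by_contra hlt
  have hpos : 0 < Nat.card S := Nat.card_pos
  have h6 : Nat.card S ≠ 6 := by
    intro e
    have : Fact (Nat.Prime 3) := ⟨Nat.prime_three⟩
    obtain ⟨g, hg⟩ := exists_prime_orderOf_dvd_card' (G := S) 3 (by rw [e]; norm_num)
    have hc : Nat.card (zpowers g) = 3 := by rw [Nat.card_zpowers, hg]
    have hi : (zpowers g).index = 2 := by
      have := (zpowers g).card_mul_index
      rw [hc, e] at this
      omega
    have hn := normal_of_index_eq_two hi
    rcases IsSimpleGroup.eq_bot_or_eq_top_of_normal _ hn with hb | hb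
    · rw [hb] at hc; simp at hc
    · rw [hb] at hi; simp at hi
  have h1 := hpp 2 0 Nat.prime_two
  have h2 := hpp 2 1 Nat.prime_two
  have h3 := hpp 3 1 Nat.prime_three
  have h4 := hpp 2 2 Nat.prime_two
  have h5 := hpp 5 1 Nat.prime_five
  have h7 := hpp 7 1 (by norm_num)
  have h8 := hpp 2 3 Nat.prime_two
  norm_num at h1 h2 h3 h4 h5 h7 h8
  omega

lemma card_cj {G : Type*} [Group G] (g : G) (H : Subgroup G) : Nat.card (cj g H) = Nat.card H :=
  Nat.card_congr (H.equivMapOfInjective _ (MulAut.conj g).injective).toEquiv.symm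

lemma cj_pow_iter {G : Type*} [Group G] (g : G) (H : Subgroup G) (i : ℕ) :
    (cj g)^[i] H = cj (g ^ i) H := by
  induction i with
  | zero => simp [cj_one]
  | succ i ih => rw [Function.iterate_succ_apply', ih, ← cj_mul, pow_succ']

lemma prod_card_le {G : Type*} [Group G] [Finite G] {K T U : Subgroup G} (hsub : K ≤ U) (hsub' : T ≤ U)
    (hd : ∀ x ∈ K, x ∈ T → x = 1) : Nat.card K * Nat.card T ≤ Nat.card U := by
  rw [← Nat.card_prod]
  let f : K × T → U := fun a => ⟨a.1.1 * a.2.1, mul_mem (hsub a.1.2) (hsub' a.2.2)⟩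
  refine Nat.card_le_card_of_injective f ?_
  rintro ⟨⟨k, hk⟩, ⟨t, ht⟩⟩ ⟨⟨k', hk'⟩, ⟨t', ht'⟩⟩ e
  have e1 : k * t = k' * t' := congrArg Subtype.val e
  have e2 : k'⁻¹ * k = t' * t⁻¹ := by
    rw [inv_mul_eq_iff_eq_mul, ← mul_assoc, ← e1]; group
  have h1 : k'⁻¹ * k = 1 := by
    refine hd _ (K.mul_mem (K.inv_mem hk') hk) ?_
    rw [e2]; exact T.mul_mem ht' (T.inv_mem ht)
  have h2 : k = k' := (inv_mul_eq_one.1 h1).symm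
  subst h2
  have h3 : t = t' := mul_left_cancel e1
  subst h3
  rfl

namespace Comps
variable {G : Type*} [Group G] {B C A M : Subgroup G} {𝓘 : Set (Subgroup G)}

lemma simple (h : Comps B C A M 𝓘) {S : Subgroup G} (hS : S ∈ 𝓘) : IsSimpleGroup S := by
  have hnt : Nontrivial S := (Subgroup.nontrivial_iff_ne_bot S).2 (h.ne S hS)
  refine ⟨fun H hH => ?_⟩
  by_cases hb : H = ⊥
  · exact Or.inl hb
  right
  have := h.simp S hS (H.map S.subtype) (Subgroup.map_subtype_le H) (by
    rw [Ne, Subgroup.map_eq_bot_iff_of_injective H S.subtype_injective]; exact hb) (by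
    rintro m hm _ ⟨x, hx, rfl⟩
    exact ⟨⟨m, hm⟩ * x * ⟨m, hm⟩⁻¹, hH.conj_mem x hx ⟨m, hm⟩, rfl⟩)
  apply Subgroup.map_injective S.subtype_injective
  rw [this, ← MonoidHom.range_eq_map, Subgroup.range_subtype]

lemma nonab' (h : Comps B C A M 𝓘) {S : Subgroup G} (hS : S ∈ 𝓘) : ∃ x y : S, x * y ≠ y * x := by
  obtain ⟨x, hx, y, hy, hxy⟩ := h.nonab S hS
  exact ⟨⟨x, hx⟩, ⟨y, hy⟩, fun e => hxy (congrArg Subtype.val e)⟩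

lemma orb [Finite G] (h : Comps B C A M 𝓘) {T : Subgroup G} (hT : T ∈ 𝓘) (d : G) :
    ∃ l e : ℕ, 0 < l ∧ 0 < e ∧ cj (d ^ l) T = T ∧
      (Set.Iio l).InjOn (fun i : ℕ => cj (d ^ i) T) ∧ e < Nat.card T ∧ 2 * e ≠ Nat.card T ∧
      ∀ t ∈ T, d ^ (l * e) * t = t * d ^ (l * e) := by
  set l := Function.minimalPeriod (cj d) T with hl
  have hper : Function.IsPeriodicPt (cj d) (orderOf d) T := by
    unfold Function.IsPeriodicPt Function.IsFixedPt
    rw [cj_pow_iter, pow_orderOf_eq_one, cj_one]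
  have hl0 : 0 < l := hper.minimalPeriod_pos (orderOf_pos d)
  have hfix : cj (d ^ l) T = T := by
    rw [← cj_pow_iter]; exact Function.iterate_minimalPeriod
  have hinj : (Set.Iio l).InjOn (fun i : ℕ => cj (d ^ i) T) := by
    have := Function.iterate_injOn_Iio_minimalPeriod (f := cj d) (x := T)
    simpa only [cj_pow_iter] using this
  have hmem : d ^ l ∈ normalizer (T : Set G) := by
    rw [mem_normalizer_iff]
    intro x
    refine ⟨fun hx => conj_mem_of_cj_eq hfix hx, fun hx => ?_⟩
    have h1 : d ^ l * x * (d ^ l)⁻¹ ∈ cj (d ^ l) T := by rw [hfix]; exact hx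
    rw [mem_cj] at h1
    convert h1 using 1
    group
  have hs := h.simple hT
  set α := T.normalizerMonoidHom ⟨d ^ l, hmem⟩ with hα
  obtain ⟨h1, h2⟩ := orderOf_mulAut (h.nonab' hT) α
  refine ⟨l, orderOf α, hl0, orderOf_pos α, hfix, hinj, h1, h2, ?_⟩
  intro t ht
  have h3 : T.normalizerMonoidHom (⟨d ^ l, hmem⟩ ^ orderOf α) = 1 := by
    rw [map_pow, ← hα, pow_orderOf_eq_one]
  have h4 := congrArg Subtype.val (DFunLike.congr_fun h3 ⟨t, ht⟩)
  have h5 : (d ^ l) ^ orderOf α * t * ((d ^ l) ^ orderOf α)⁻¹ = t := h4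
  rw [← pow_mul] at h5
  exact mul_inv_eq_iff_eq_mul.1 h5

lemma card_eq (h : Comps B C A M 𝓘) {T T' : Subgroup G} (hT : T ∈ 𝓘) (hT' : T' ∈ 𝓘) :
    Nat.card T' = Nat.card T := by
  obtain ⟨g, rfl⟩ := h.trans T hT T' hT'
  exact card_cj g T

lemma sq_bound (l s : ℕ) (hl : 2 ≤ l) (hs : 9 ≤ s) : (l * s) ^ 2 ≤ (2 * s) ^ l := by
  induction l, hl using Nat.le_induction with
  | base => exact le_rfl
  | succ l hl ih =>
    rw [pow_succ (2 * s) l]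
    have : ((l + 1) * s) ^ 2 ≤ (l * s) ^ 2 * (2 * s) := by
      have e1 : ((l + 1) * s) ^ 2 = (l+1)^2 * s^2 := by ring
      have e2 : (l * s) ^ 2 * (2 * s) = (l^2 * (2 * s)) * s^2 := by ring
      rw [e1, e2]
      apply Nat.mul_le_mul_right
      nlinarith
    exact this.trans (Nat.mul_le_mul_right _ ih)

lemma period_bound [Finite G] (h : Comps B C A M 𝓘) (d : G) (hd : ∀ T ∈ 𝓘, cj d T ≠ T) (s : ℕ)
    (hs : ∀ T ∈ 𝓘, Nat.card T = s) (hs9 : 9 ≤ s) (n : ℕ) :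
    ∀ Y : Finset (Subgroup G), Y.card = n → (∀ T ∈ Y, T ∈ 𝓘) → (∀ x ∈ zpowers d, ∀ T ∈ Y, cj x T ∈ Y) →
    ∃ p : ℕ, 0 < p ∧ p ^ 2 ≤ (2 * s) ^ n ∧ ∀ T ∈ Y, ∀ t ∈ T, d ^ p * t = t * d ^ p := by
  classical
  induction n using Nat.strong_induction_on with
  | _ n ih =>
  intro Y hYn hY hinv
  rcases Y.eq_empty_or_nonempty with rfl | ⟨T, hT⟩
  · refine ⟨1, one_pos, ?_, by simp⟩
    rw [one_pow]
    exact Nat.one_le_pow _ _ (by omega)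
  obtain ⟨l, e, hl, he, hfix, hinj, hes, -, hcomm⟩ := h.orb (hY T hT) d
  have hl2 : 2 ≤ l := by
    rcases Nat.lt_or_ge 1 l with h1 | h1
    · exact h1
    · have : l = 1 := by omega
      rw [this, pow_one] at hfix
      exact absurd hfix (hd T (hY T hT))
  set O := Y.filter (fun T' => ∃ x ∈ zpowers d, cj x T = T') with hO
  have hlO : l ≤ O.card := by
    have : (Finset.range l).card ≤ O.card := by
      refine Finset.card_le_card_of_injOn (fun i : ℕ => cj (d ^ i) T) ?_ ?_
      · intro i _
        have hm : d ^ i ∈ zpowers d := pow_mem (mem_zpowers d) i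
        simp only [hO, Finset.coe_filter]
        exact ⟨hinv _ hm T hT, d ^ i, hm, rfl⟩
      · intro i hi j hj
        simp only [Finset.coe_range] at hi hj
        exact hinj hi hj
    simpa using this
  have hcard : (Y \ O).card + O.card = n := by
    rw [← hYn]; exact Finset.card_sdiff_add_card_eq_card (Finset.filter_subset _ _)
  obtain ⟨p, hp, hpb, hpc⟩ := ih (Y \ O).card (by omega) (Y \ O) rfl
    (fun T' hT' => hY T' (Finset.mem_sdiff.1 hT').1) (by
      intro x hx T' hT'
      obtain ⟨h1, h2⟩ := Finset.mem_sdiff.1 hT'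
      refine Finset.mem_sdiff.2 ⟨hinv x hx T' h1, fun h3 => h2 ?_⟩
      obtain ⟨-, y, hy, e⟩ := Finset.mem_filter.1 h3
      refine Finset.mem_filter.2 ⟨h1, x⁻¹ * y, mul_mem (inv_mem hx) hy, ?_⟩
      rw [cj_mul, e, cj_inv_cj])
  refine ⟨p * (l * e), by positivity, ?_, ?_⟩
  · have h1 : (l * e) ^ 2 ≤ (2 * s) ^ O.card := by
      calc (l * e) ^ 2 ≤ (l * s) ^ 2 := by
            apply Nat.pow_le_pow_left
            apply Nat.mul_le_mul_left
            rw [hs T (hY T hT)] at hes; omega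
        _ ≤ (2 * s) ^ l := sq_bound l s hl2 hs9
        _ ≤ (2 * s) ^ O.card := Nat.pow_le_pow_right (by omega) hlO
    rw [mul_pow, ← hcard, pow_add]
    exact Nat.mul_le_mul hpb h1
  · intro T' hT' t ht
    have hpow : ∀ (a : G) (k : ℕ), a * t = t * a → a ^ k * t = t * a ^ k := fun a k hc =>
      (Commute.pow_left (show Commute a t from hc) k)
    by_cases hO' : T' ∈ O
    · obtain ⟨-, x, hx, e'⟩ := Finset.mem_filter.1 hO'
      rw [mul_comm p, pow_mul]
      apply hpow
      rw [← e', mem_cj] at ht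
      have h1 := hcomm _ ht
      have hc : d ^ (l * e) * x = x * d ^ (l * e) := by
        obtain ⟨k, rfl⟩ := mem_zpowers_iff.1 hx
        rw [← zpow_natCast, ← zpow_add, ← zpow_add, add_comm]
      set D := d ^ (l * e)
      calc D * t = D * x * (x⁻¹ * t * x) * x⁻¹ := by group
        _ = x * (D * (x⁻¹ * t * x)) * x⁻¹ := by rw [hc]; group
        _ = t * (x * D) * x⁻¹ := by rw [h1]; group
        _ = t * D := by rw [← hc]; group
    · rw [pow_mul]
      apply hpow
      exact hpc T' (Finset.mem_sdiff.2 ⟨hT', hO'⟩) t ht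

lemma card_sSup_ge [Finite G] (h : Comps B C A M 𝓘) (s : ℕ)
    (hs : ∀ T ∈ 𝓘, Nat.card T = s) (Y : Finset (Subgroup G)) (hY : ∀ T ∈ Y, T ∈ 𝓘) :
    s ^ Y.card ≤ Nat.card (sSup (Y : Set (Subgroup G)) : Subgroup G) := by
  classical
  induction Y using Finset.induction with
  | empty => simpa using Nat.card_pos
  | insert T Y hT ih =>
    rw [Finset.card_insert_of_notMem hT, pow_succ]
    have hTI := hY T (Finset.mem_insert_self T Y)
    have hYI : (Y : Set (Subgroup G)) ⊆ 𝓘 := fun T' h' => hY T' (Finset.mem_insert_of_mem h')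
    refine le_trans (Nat.mul_le_mul (ih hYI) (hs T hTI).ge) ?_
    refine prod_card_le (sSup_le_sSup (by simp)) (le_sSup (by simp)) ?_
    intro x hx hx'
    have hx'' : x ∈ sSup ({T} : Set (Subgroup G)) := by rw [sSup_singleton]; exact hx'
    refine h.disj hYI (Set.singleton_subset_iff.2 hTI) ?_ hx hx''
    rintro T' hT' rfl
    exact hT hT'

end Comps
end MonoFact

namespace MonoFact
open Subgroup
open scoped commutatorElement
namespace Comps
variable {G : Type*} [Group G] {B C A M : Subgroup G} {𝓘 : Set (Subgroup G)}

lemma pow_bound (k s n : ℕ) (hk : 3 ≤ k) (hs : 9 ≤ s) (h1 : s ^ (k - 1) ≤ n) (h2 : n ^ 2 ≤ (2 * s) ^ k) :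
    False := by
  obtain ⟨j, rfl⟩ : ∃ j, k = j + 3 := ⟨k - 3, by omega⟩
  have e : j + 3 - 1 = j + 2 := by omega
  rw [e] at h1
  have h3 : (s ^ (j + 2)) ^ 2 ≤ (2 * s) ^ (j + 3) := (Nat.pow_le_pow_left h1 2).trans h2
  have e1 : (s ^ (j + 2)) ^ 2 = s ^ (j + 1) * s ^ (j + 3) := by ring
  rw [e1, mul_pow] at h3
  have h4 : s ^ (j + 1) ≤ 2 ^ (j + 3) := Nat.le_of_mul_le_mul_right h3 (by positivity)
  have h5 : 9 ^ (j + 1) ≤ s ^ (j + 1) := Nat.pow_le_pow_left hs _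
  have h6 : 2 ^ (j + 3) < 9 ^ (j + 1) := by
    have : 2 ^ j ≤ 9 ^ j := Nat.pow_le_pow_left (by norm_num) j
    have : 0 < 9 ^ j := by positivity
    rw [pow_add, pow_succ 9]
    omega
  omega

lemma diag_finish [Finite G] (h : Comps B C A M 𝓘)
    (hfull : ∀ T ∈ 𝓘, (M ⊓ B) ⊔ sSup (𝓘 \ {T}) = M)
    (hdiag : ∀ T ∈ 𝓘, ∀ x, x ∈ M → x ∈ B → x ∈ sSup (𝓘 \ {T}) → x = 1) :
    ∀ T ∈ 𝓘, ∀ T' ∈ 𝓘, T = T' := by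
  classical
  intro T1 hT1 T2 hT2
  by_contra hne
  obtain ⟨d, hdC, hdΓ, hord, hgen, hΓ⟩ := h.exists_gen
  have hKM : ∀ T, sSup (𝓘 \ {T}) ≤ M := fun T => sSup_le fun T' h' => h.le T' h'.1
  -- no fixed component
  have hnofix : ∀ T ∈ 𝓘, cj d T ≠ T := by
    intro T hT hfix
    obtain ⟨T', hT', hTT'⟩ : ∃ T' ∈ 𝓘, T' ≠ T := by
      by_cases e : T1 = T
      · exact ⟨T2, hT2, fun e' => hne (e.trans e'.symm)⟩
      · exact ⟨T1, hT1, e⟩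
    have hmem : T' ∈ 𝓘 \ {T} := ⟨hT', hTT'⟩
    refine h.not_solvable hT' (le_sSup hmem) ?_
    have hcjK : cj d (sSup (𝓘 \ {T})) = sSup (𝓘 \ {T}) := by
      have hsub : cj d (sSup (𝓘 \ {T})) ≤ sSup (𝓘 \ {T}) := by
        rw [cj_sSup]
        apply sSup_le
        rintro _ ⟨S, hS, rfl⟩
        apply le_sSup
        refine ⟨h.conj d S hS.1, fun e => hS.2 ?_⟩
        have e' : cj d S = cj d T := by rw [hfix]; exact e
        exact cj_inj.1 e'
      exact Subgroup.eq_of_le_of_card_ge hsub (card_cj _ _).ge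
    refine solvable_of_inf_eq_bot B (sSup (𝓘 \ {T})) (zpowers d) ?_ ?_ ?_ ?_
    · intro x hx y hy
      exact h.stp.comm x ((zpowers_le.2 hdC) hx) y ((zpowers_le.2 hdC) hy)
    · have : Nz (zpowers d) (sSup (𝓘 \ {T})) := by
        rw [nz_iff, zpowers_le, mem_normalizer_iff]
        intro x
        refine ⟨fun hx => conj_mem_of_cj_eq hcjK hx, fun hx => ?_⟩
        rw [← hcjK, mem_cj] at hx
        convert hx using 1
        group
      exact this
    · intro x hx hxB
      exact hdiag T hT x (hKM T hx) hxB hx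
    · intro x hx
      obtain ⟨j, b, hb, e⟩ := hΓ x⁻¹ (le_sup_left (a := M) (inv_mem (hKM T hx)))
      refine ⟨b⁻¹, B.inv_mem hb, (d ^ j)⁻¹, inv_mem (pow_mem (mem_zpowers d) j), ?_⟩
      rw [← mul_inv_rev, ← e, inv_inv]
  -- |D| = |T^c|
  have hcardD : orderOf d = Nat.card (sSup (𝓘 \ {T1}) : Subgroup G) := by
    apply le_antisymm
    · rw [hord]
      refine card_le_of _ _ B ?_ ?_
      · intro x hx
        obtain ⟨m, hm, b, hb, rfl⟩ := (mem_sup_normal h.Mn).1 hx.2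
        rw [← hfull T1 hT1, sup_comm] at hm
        have hnz : Nz (M ⊓ B) (sSup (𝓘 \ {T1})) := (h.nor_sSup (fun _ h => h.1)).mono inf_le_left
        obtain ⟨k, hk, r, hr, rfl⟩ := (mem_sup_nz hnz).1 hm
        exact ⟨k, hk, r * b, B.mul_mem hr.2 hb, mul_assoc _ _ _⟩
      · intro x hx hxB
        exact h.stp.inter hxB hx.1
    · rw [hord]
      refine card_le_of _ _ B ?_ ?_
      · intro x hx
        obtain ⟨j, b, hb, e⟩ := hΓ x (le_sup_left (a := M) (hKM T1 hx))
        exact ⟨d ^ j, pow_mem (⟨hdC, hdΓ⟩ : d ∈ C ⊓ (M ⊔ B)) j, b, hb, e⟩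
      · intro x hx hxB
        exact hdiag T1 hT1 x (hKM T1 hx) hxB hx
  set s := Nat.card T1 with hs
  have hsT : ∀ T ∈ 𝓘, Nat.card T = s := fun T hT => h.card_eq hT1 hT
  have hs9 : 9 ≤ s := by
    have := h.simple hT1
    exact card_simple_ge (h.nonab' hT1)
  set F := (Set.toFinite 𝓘).toFinset with hF
  have hFm : ∀ T, T ∈ F ↔ T ∈ 𝓘 := fun T => by simp [hF]
  have hkill : ∀ p : ℕ, (∀ T ∈ 𝓘, ∀ t ∈ T, d ^ p * t = t * d ^ p) → d ^ p = 1 := by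
    intro p hp
    apply h.Mcent
    have : Cm M (zpowers (d ^ p)) := by
      rw [← h.sup]
      apply cm_sSup
      intro T hT t ht x hx
      obtain ⟨k, rfl⟩ := mem_zpowers_iff.1 hx
      exact (Commute.zpow_left (show Commute (d ^ p) t from hp T hT t ht) k).symm
    intro m hm
    exact (this m hm _ (mem_zpowers _)).symm
  have hT12 : {T1, T2} ⊆ F := by
    intro T hT
    rw [hFm]
    rcases Finset.mem_insert.1 hT with rfl | hT
    · exact hT1
    · rw [Finset.mem_singleton.1 hT]; exact hT2
  have hcard2 : ({T1, T2} : Finset (Subgroup G)).card = 2 := Finset.card_pair hne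
  have hk2 : 2 ≤ F.card := by rw [← hcard2]; exact Finset.card_le_card hT12
  rcases Nat.lt_or_ge 2 F.card with hk | hk
  · obtain ⟨p, hp0, hpb, hpc⟩ := h.period_bound d hnofix s hsT hs9 F.card F rfl (fun T hT => (hFm T).1 hT)
      (fun x _ T hT => (hFm _).2 (h.conj x T ((hFm T).1 hT)))
    have hd1 := hkill p (fun T hT => hpc T ((hFm T).2 hT))
    have hop : orderOf d ≤ p := orderOf_le_of_pow_eq_one hp0 hd1
    refine pow_bound F.card s (orderOf d) hk hs9 ?_ ((Nat.pow_le_pow_left hop 2).trans hpb)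
    rw [hcardD]
    have h1 := h.card_sSup_ge s hsT (F.erase T1) (fun T hT => (hFm T).1 (Finset.mem_of_mem_erase hT))
    rw [Finset.card_erase_of_mem ((hFm T1).2 hT1)] at h1
    have e : ((F.erase T1 : Finset (Subgroup G)) : Set (Subgroup G)) = 𝓘 \ {T1} := by
      rw [Finset.coe_erase, hF, Set.Finite.coe_toFinset]
    rwa [e] at h1
  · have hFe : F = {T1, T2} := (Finset.eq_of_subset_of_card_le hT12 (by omega)).symm
    have h𝓘 : ∀ T ∈ 𝓘, T = T1 ∨ T = T2 := by
      intro T hT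
      have := (hFm T).2 hT
      rw [hFe] at this
      simpa using this
    have hc : sSup (𝓘 \ {T1}) = T2 := by
      have : 𝓘 \ {T1} = {T2} := by
        ext T
        constructor
        · rintro ⟨hT, hT'⟩
          exact (h𝓘 T hT).resolve_left hT'
        · rintro rfl
          exact ⟨hT2, fun e => hne e.symm⟩
      rw [this, sSup_singleton]
    rw [hc, hsT T2 hT2] at hcardD
    obtain ⟨l, e, hl, he, hfix, hinj, hes, h2e, hcomm⟩ := h.orb hT1 d
    have hdT1 : cj d T1 = T2 := (h𝓘 _ (h.conj d T1 hT1)).resolve_left (hnofix T1 hT1)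
    have hl2 : l ≤ 2 := by
      by_contra hgt
      have hdT2 : cj d T2 = T1 := (h𝓘 _ (h.conj d T2 hT2)).resolve_right (hnofix T2 hT2)
      have : (2 : ℕ) = 0 := hinj (Set.mem_Iio.2 (by omega)) (Set.mem_Iio.2 (by omega)) (by
        simp only [pow_zero, cj_one, pow_two, cj_mul, hdT1, hdT2])
      omega
    have hd1 := hkill (l * e) (by
      intro T hT t ht
      rcases h𝓘 T hT with rfl | rfl
      · exact hcomm t ht
      · rw [← hdT1, mem_cj] at ht
        have h1 := hcomm _ ht
        have hc : d ^ (l * e) * d = d * d ^ (l * e) := by rw [← pow_succ, pow_succ']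
        set D := d ^ (l * e)
        calc D * t = D * d * (d⁻¹ * t * d) * d⁻¹ := by group
          _ = d * (D * (d⁻¹ * t * d)) * d⁻¹ := by rw [hc]; group
          _ = t * (d * D) * d⁻¹ := by rw [h1]; group
          _ = t * D := by rw [← hc]; group)
    have hdvd := orderOf_dvd_of_pow_eq_one hd1
    rw [hcardD] at hdvd
    obtain ⟨q, hq⟩ := hdvd
    have hle : l * e ≤ 2 * e := Nat.mul_le_mul_right _ hl2
    have hq1 : q = 1 := by
      have hq0 : q ≠ 0 := by
        rintro rfl
        have : 0 < l * e := Nat.mul_pos hl he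
        omega
      have : q < 2 := by
        by_contra hq2
        have : s * 2 ≤ s * q := Nat.mul_le_mul_left s (by omega)
        omega
      omega
    rw [hq1, mul_one] at hq
    have hl12 : l = 1 ∨ l = 2 := by omega
    rcases hl12 with rfl | rfl <;> omega

lemma one [Finite G] (h : Comps B C A M 𝓘) : ∀ T ∈ 𝓘, ∀ T' ∈ 𝓘, T = T' := by
  by_cases hfull : ∀ T ∈ 𝓘, (M ⊓ B) ⊔ sSup (𝓘 \ {T}) = M
  · exact h.diag_finish hfull (h.diag hfull)
  · push Not at hfull
    obtain ⟨T0, hT0, hW⟩ := hfull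
    have := h.wl 𝓘 h.le h.nor h.comm h.sup (fun y _ => h.conj y) h.Btrans T0 hT0 hW
    intro T hT T' hT'
    rw [this T hT, this T' hT']

end Comps
end MonoFact


/-- Let `G = BC` with `B` and `C` core-free, `B` monolithic and `C`
cyclic. Then `G` is almost simple: it has a non-abelian simple normal subgroup
with trivial centralizer. -/
theorem stmt_6 {G : Type*} [Group G] [Finite G] (B C : Subgroup G)
    (hfact : ∀ g : G, ∃ b ∈ B, ∃ c ∈ C, g = b * c)
    (hCcyc : IsCyclic ↥C)
    (hCcorefree : ∀ N : Subgroup G, N.Normal → N ≤ C → N = ⊥)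
    (hBcorefree : ∀ N : Subgroup G, N.Normal → N ≤ B → N = ⊥)
    (hBmono : ∃ A : Subgroup G, A ≤ B ∧ A ≠ ⊥ ∧
      (∀ b ∈ B, ∀ a ∈ A, b * a * b⁻¹ ∈ A) ∧
      (∀ N : Subgroup G, N ≤ B → (∀ b ∈ B, ∀ n ∈ N, b * n * b⁻¹ ∈ N) → N ≠ ⊥ → A ≤ N) ∧
      (∃ a ∈ A, ∃ a' ∈ A, a * a' ≠ a' * a)) :
    ∃ S : Subgroup G, S.Normal ∧ IsSimpleGroup ↥S ∧
      (∃ x ∈ S, ∃ y ∈ S, x * y ≠ y * x) ∧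
      Subgroup.centralizer (S : Set G) = ⊥ := by
  obtain ⟨A, h1, h2, h3, h4, h5⟩ := hBmono
  have hS : MonoFact.Setup B C A := ⟨hfact, hCcyc, hCcorefree, hBcorefree, h1, h2, h3, h4, h5⟩
  obtain ⟨M, 𝓘, h⟩ := MonoFact.exists_comps hS
  exact h.final h.one
end

section
/- Let G be a finite group, B a subgroup of G, and y ∈ G such that G = B⟨y⟩ (every element of G is a product b*y^k), B ∩ ⟨y⟩ = 1, and ⟨y⟩ is core-free in G. Let φ : B → B be the skew morphism induced by y, i.e. the (unique) function satisfying y*b ∈ φ(b)·⟨y⟩ for all b ∈ B. Then φ is a group homomorphism (equivalently, an automorphism of B) if and only if B is normal in G. -/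
/-- Let `G = B⟨y⟩` with `B ⊓ ⟨y⟩ = 1` and `⟨y⟩` core-free in `G`, and let
`φ` be the skew morphism of `B` induced by `y`. Then `φ` is a group homomorphism if
and only if `B` is normal in `G`. -/
theorem stmt_7 {G : Type*} [Group G] [Finite G] (B : Subgroup G) (y : G)
    (hfact : ∀ g : G, ∃ b ∈ B, ∃ c ∈ Subgroup.zpowers y, g = b * c)
    (hint : B ⊓ Subgroup.zpowers y = ⊥)
    (hYcorefree : ∀ N : Subgroup G, N.Normal → N ≤ Subgroup.zpowers y → N = ⊥)
    (φ : B → B)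
    (hφ : ∀ b : B, ∃ u ∈ Subgroup.zpowers y, y * (b : G) = (φ b : G) * u) :
    (∀ a b : B, φ (a * b) = φ a * φ b) ↔ B.Normal := by
  have huniq : ∀ a ∈ B, ∀ b ∈ B, ∀ u ∈ Subgroup.zpowers y, ∀ v ∈ Subgroup.zpowers y,
      a * u = b * v → a = b := by
    intro a ha b hb u hu v hv h
    have h1 : b⁻¹ * a = v * u⁻¹ := by
      rw [inv_mul_eq_iff_eq_mul, ← mul_assoc, ← h, mul_inv_cancel_right]
    have h2 : b⁻¹ * a ∈ B ⊓ Subgroup.zpowers y := by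
      refine Subgroup.mem_inf.mpr ⟨mul_mem (inv_mem hb) ha, ?_⟩
      rw [h1]
      exact mul_mem hv (inv_mem hu)
    rw [hint, Subgroup.mem_bot, inv_mul_eq_one] at h2
    exact h2.symm
  constructor
  · intro hom
    have key : ∀ a : B, y * (a : G) = φ a * y := by
      intro a
      have hcore : (φ a * y)⁻¹ * (y * (a : G)) ∈ (Subgroup.zpowers y).normalCore := by
        intro x
        obtain ⟨b, hb, c, hc, hx⟩ := hfact x⁻¹
        obtain ⟨u, hu, hu'⟩ := hφ (a * ⟨b, hb⟩)
        obtain ⟨v, hv, hv'⟩ := hφ ⟨b, hb⟩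
        rw [hom] at hu'
        simp only [Subgroup.coe_mul] at hu' hv'
        have hx' : x = c⁻¹ * b⁻¹ := by rw [← inv_inv x, hx, mul_inv_rev]
        have hf : (φ ⟨b, hb⟩ : G) = y * b * v⁻¹ := by rw [hv', mul_inv_cancel_right]
        have e : x * ((φ a * y)⁻¹ * (y * (a : G))) * x⁻¹ = c⁻¹ * (v⁻¹ * u) * c := by
          calc _ = c⁻¹ * b⁻¹ * (φ a * y)⁻¹ * (y * (a * b)) * c := by rw [hx, hx']; group
            _ = c⁻¹ * (v⁻¹ * u) * c := by rw [hu', hf]; group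
        rw [e]
        exact mul_mem (mul_mem (inv_mem hc) (mul_mem (inv_mem hv) hu)) hc
      rw [hYcorefree _ inferInstance (Subgroup.normalCore_le _), Subgroup.mem_bot,
        inv_mul_eq_one] at hcore
      exact hcore.symm
    have hpow : ∀ k : ℕ, ∀ b ∈ B, y ^ k * b * (y ^ k)⁻¹ ∈ B := by
      intro k
      induction k with
      | zero => intro b hb; simpa using hb
      | succ k ih =>
        intro b hb
        have h := ih _ (φ ⟨b, hb⟩).2
        have hk : (φ ⟨b, hb⟩ : G) = y * b * y⁻¹ := by
          rw [key ⟨b, hb⟩, mul_inv_cancel_right]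
        rw [hk] at h
        convert h using 1
        rw [pow_succ]
        group
    refine ⟨fun n hn g => ?_⟩
    obtain ⟨b, hb, c, hc, hg⟩ := hfact g
    obtain ⟨k, rfl⟩ := (mem_powers_iff_mem_zpowers.mpr hc)
    have h := mul_mem (mul_mem hb (hpow k n hn)) (inv_mem hb)
    convert h using 1
    rw [hg]
    simp only [mul_inv_rev, mul_assoc]
  · intro hN
    have key : ∀ b : B, (φ b : G) = y * b * y⁻¹ := by
      intro b
      obtain ⟨u, hu, h⟩ := hφ b
      refine huniq _ (φ b).2 _ (hN.conj_mem _ b.2 y) u hu y (Subgroup.mem_zpowers y) ?_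
      rw [← h, inv_mul_cancel_right]
    intro a b
    apply Subtype.ext
    simp only [Subgroup.coe_mul, key]
    group
end

section
/- Let G be a finite group with subgroups B and Y such that G = BY (every element of G is a product b*y), B ∩ Y = 1, Y is cyclic, and Y is core-free in G. Suppose y, y′ ∈ Y and there exist functions c : B → B and k : B → ℕ such that y·b = c(b)·y^{k(b)} and y′·b = c(b)·(y′)^{k(b)} for all b ∈ B (i.e. y and y′ induce the same skew morphism of B, with the same power function). Then y = y′. -/
/-- Let `G = BY` with `B ⊓ Y = 1`, `Y` cyclic and core-free in `G`.
If `y, y' ∈ Y` induce the same skew morphism of `B` with the same power function,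
then `y = y'`. -/
theorem stmt_8 {G : Type*} [Group G] [Finite G] (B Y : Subgroup G)
    (hfact : ∀ g : G, ∃ b ∈ B, ∃ c ∈ Y, g = b * c)
    (hint : B ⊓ Y = ⊥)
    (hYcyc : IsCyclic ↥Y)
    (hYcorefree : ∀ N : Subgroup G, N.Normal → N ≤ Y → N = ⊥)
    (y y' : G) (hy : y ∈ Y) (hy' : y' ∈ Y)
    (c : B → B) (k : B → ℕ)
    (h1 : ∀ b : B, y * (b : G) = (c b : G) * y ^ (k b))
    (h2 : ∀ b : B, y' * (b : G) = (c b : G) * y' ^ (k b)) :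
    y = y' := by
  have hN : Y.normalCore = ⊥ := hYcorefree _ inferInstance Y.normalCore_le
  have hm : y⁻¹ * y' ∈ Y.normalCore := by
    intro g
    obtain ⟨b, hb, t, ht, hg⟩ := hfact g⁻¹
    have e1 := h1 ⟨b, hb⟩
    have e2 := h2 ⟨b, hb⟩
    simp only at e1 e2
    have key : g * (y⁻¹ * y') * g⁻¹ =
        t⁻¹ * ((y ^ k ⟨b, hb⟩)⁻¹ * y' ^ k ⟨b, hb⟩) * t := by
      have hg' : g = t⁻¹ * b⁻¹ := by rw [← inv_inv g, hg, mul_inv_rev]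
      calc g * (y⁻¹ * y') * g⁻¹ = t⁻¹ * ((y * b)⁻¹ * (y' * b)) * t := by
            rw [hg']; group
        _ = _ := by rw [e1, e2]; group
    rw [key]
    exact Y.mul_mem (Y.mul_mem (Y.inv_mem ht)
      (Y.mul_mem (Y.inv_mem (Y.pow_mem hy _)) (Y.pow_mem hy' _))) ht
  rw [hN, Subgroup.mem_bot] at hm
  exact inv_mul_eq_one.mp hm
end

section
/- Let B be a finite group that is almost simple with socle A, i.e. A is a non-abelian simple normal subgroup of B whose centralizer in B is trivial. Let G be a finite group containing B and a cyclic core-free subgroup Y with G = BY (every element of G is a product b*y) and B ∩ Y = 1, and suppose B is not core-free in G. Let y be a generator of Y and let φ : B → B be the induced skew morphism, i.e. the unique function with y·b ∈ φ(b)·Y for all b ∈ B. Then φ(a) = y·a·y⁻¹ for every a ∈ A; in particular φ maps A bijectively onto A and the restriction of φ to A is a group automorphism of A. -/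
/-- A nontrivial subgroup of `B` normalised by `A` contains `A`. -/
theorem le_of_normalised {G : Type*} [Group G] (B A M : Subgroup G)
    (hAnormB : ∀ b ∈ B, ∀ a ∈ A, b * a * b⁻¹ ∈ A)
    (hAsimple : IsSimpleGroup ↥A)
    (hAcent : ∀ b ∈ B, (∀ a ∈ A, b * a = a * b) → b = 1)
    (hMB : M ≤ B) (hM : ∀ a ∈ A, ∀ m ∈ M, a * m * a⁻¹ ∈ M) (hne : M ≠ ⊥) : A ≤ M := by
  have hn : (M.subgroupOf A).Normal := by
    refine ⟨fun m hm a => ?_⟩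
    rw [Subgroup.mem_subgroupOf] at hm ⊢
    exact hM a a.2 m hm
  rcases hn.eq_bot_or_eq_top with h | h
  · exfalso
    apply hne
    rw [Subgroup.eq_bot_iff_forall]
    intro m hm
    refine hAcent m (hMB hm) fun a ha => ?_
    have h1 : m * a * m⁻¹ * a⁻¹ ∈ A := A.mul_mem (hAnormB m (hMB hm) a ha) (A.inv_mem ha)
    have h2 : m * a * m⁻¹ * a⁻¹ ∈ M := by
      have := M.mul_mem hm (hM a ha _ (M.inv_mem hm))
      simpa only [mul_assoc] using this
    rw [Subgroup.subgroupOf_eq_bot] at h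
    have h3 : m * a * m⁻¹ * a⁻¹ = 1 := Subgroup.disjoint_def.mp h h2 h1
    rw [mul_inv_eq_one, mul_inv_eq_iff_eq_mul] at h3
    exact h3
  · exact Subgroup.subgroupOf_eq_top.mp h

/-- Let `B ≤ G` be almost simple with socle `A`, and `G = BY` with
`Y = ⟨y⟩` cyclic core-free, `B ⊓ Y = 1`, and `B` not core-free in `G`. Then the skew
morphism `φ` induced by `y` satisfies `φ(a) = y a y⁻¹` for all `a ∈ A`; in particular
conjugation by `y` maps `A` bijectively onto `A`, so `φ` restricts to an automorphism
of `A`. -/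
theorem stmt_10 {G : Type*} [Group G] [Finite G] (B Y A : Subgroup G)
    (hAB : A ≤ B)
    (hAnormB : ∀ b ∈ B, ∀ a ∈ A, b * a * b⁻¹ ∈ A)
    (hAsimple : IsSimpleGroup ↥A)
    (hAnonab : ∃ a ∈ A, ∃ a' ∈ A, a * a' ≠ a' * a)
    (hAcent : ∀ b ∈ B, (∀ a ∈ A, b * a = a * b) → b = 1)
    (hfact : ∀ g : G, ∃ b ∈ B, ∃ u ∈ Y, g = b * u)
    (hint : B ⊓ Y = ⊥)
    (hYcorefree : ∀ N : Subgroup G, N.Normal → N ≤ Y → N = ⊥)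
    (hBnotcorefree : ∃ N : Subgroup G, N.Normal ∧ N ≤ B ∧ N ≠ ⊥)
    (y : G) (hy : Subgroup.zpowers y = Y)
    (φ : B → B)
    (hφ : ∀ b : B, ∃ u ∈ Y, y * (b : G) = (φ b : G) * u) :
    (∀ a : G, ∀ ha : a ∈ A, ((φ ⟨a, hAB ha⟩ : ↥B) : G) = y * a * y⁻¹) ∧
      (∀ a ∈ A, y * a * y⁻¹ ∈ A) ∧
      (∀ a ∈ A, ∃ a' ∈ A, y * a' * y⁻¹ = a) := by
  obtain ⟨N, hN, hNB, hNne⟩ := hBnotcorefree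
  have hAN : A ≤ N := le_of_normalised B A N hAnormB hAsimple hAcent hNB
    (fun a _ m hm => hN.conj_mem m hm a) hNne
  have key : ∀ g : G, ∀ a ∈ A, g⁻¹ * a * g ∈ A := by
    intro g
    have hle : A ≤ A.map (MulAut.conj g).toMonoidHom := by
      refine le_of_normalised B A _ hAnormB hAsimple hAcent ?_ ?_ ?_
      · rintro _ ⟨x, hx, rfl⟩
        exact hNB (hN.conj_mem x (hAN hx) g)
      · rintro a ha _ ⟨x, hx, rfl⟩
        have h1 : g⁻¹ * a * g ∈ B := by
          have := hN.conj_mem a (hAN ha) g⁻¹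
          rw [inv_inv] at this
          exact hNB this
        refine ⟨_, hAnormB _ h1 x hx, ?_⟩
        simp [mul_assoc]
      · intro h
        rw [Subgroup.map_eq_bot_iff_of_injective _ (MulAut.conj g).injective] at h
        obtain ⟨a, ha, a', ha', hh⟩ := hAnonab
        rw [h, Subgroup.mem_bot] at ha ha'
        exact hh (by rw [ha, ha'])
    intro a ha
    obtain ⟨x, hx, hxa⟩ := hle ha
    have : g * x * g⁻¹ = a := hxa
    rw [← this]
    simpa [mul_assoc] using hx
  have key2 : ∀ a ∈ A, y * a * y⁻¹ ∈ A := by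
    intro a ha
    simpa using key y⁻¹ a ha
  refine ⟨?_, key2, fun a ha => ⟨_, key y a ha, by group⟩⟩
  intro a ha
  obtain ⟨u, hu, h⟩ := hφ ⟨a, hAB ha⟩
  have hyY : y ∈ Y := hy ▸ Subgroup.mem_zpowers y
  set b : G := ((φ ⟨a, hAB ha⟩ : ↥B) : G) with hb
  have hbB : b ∈ B := (φ ⟨a, hAB ha⟩).2
  change y * a = b * u at h
  have e : b⁻¹ * (y * a * y⁻¹) = u * y⁻¹ := by
    rw [h]; group
  have h1 : b⁻¹ * (y * a * y⁻¹) ∈ B ⊓ Y :=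
    ⟨B.mul_mem (B.inv_mem hbB) (hAB (key2 a ha)), e ▸ Y.mul_mem hu (Y.inv_mem hyY)⟩
  rw [hint, Subgroup.mem_bot, inv_mul_eq_one] at h1
  exact h1
end

section
/- Let G be a finite group with subgroups B and Y such that G = BY (every element of G is a product b*y), B ∩ Y = 1, Y is cyclic and core-free in G, and B is not core-free in G. Suppose B is monolithic with monolith A (regarded as a subgroup of G), that the index of A in B is 2, and that the conjugation action of B on A induces an isomorphism from B onto the full automorphism group Aut(A) (equivalently, the homomorphism B → Aut(A) given by conjugation is bijective). Then, writing C = C_G(A) for the centralizer of A in G: (i) C is normal in G, C ∩ B = 1 and CB = G (so G = C ⋊ B); (ii) |C| = |Y|; (iii) there exists b ∈ B with |C| ≤ ord(b), i.e. |C| is at most the maximum order of an element of B; and (iv) C has a cyclic subgroup of index at most two, i.e. there is a cyclic subgroup W ≤ C with |C| ≤ 2|W|. -/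
/-- Let `G = BY` be a skew product group (`B ⊓ Y = 1`, `Y` cyclic
core-free) with `B` not core-free in `G`, where `B` is monolithic with monolith `A`
of index 2 in `B`, and conjugation induces an isomorphism `B ≅ Aut(A)`. Then, with
`C = C_G(A)`: `G = C ⋊ B`, `|C| = |Y|`, `|C|` is at most the maximal order of an
element of `B`, and `C` has a cyclic subgroup of index at most two. -/
theorem stmt_11 {G : Type*} [Group G] [Finite G] (B Y A : Subgroup G)
    (hfact : ∀ g : G, ∃ b ∈ B, ∃ u ∈ Y, g = b * u)
    (hint : B ⊓ Y = ⊥)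
    (hYcyc : IsCyclic ↥Y)
    (hYcorefree : ∀ N : Subgroup G, N.Normal → N ≤ Y → N = ⊥)
    (hBnotcorefree : ∃ N : Subgroup G, N.Normal ∧ N ≤ B ∧ N ≠ ⊥)
    (hAB : A ≤ B) (hAne : A ≠ ⊥)
    (hAnormB : ∀ b ∈ B, ∀ a ∈ A, b * a * b⁻¹ ∈ A)
    (hAmin : ∀ N : Subgroup G, N ≤ B → (∀ b ∈ B, ∀ n ∈ N, b * n * b⁻¹ ∈ N) →
      N ≠ ⊥ → A ≤ N)
    (hAnonab : ∃ a ∈ A, ∃ a' ∈ A, a * a' ≠ a' * a)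
    (hindex2 : Nat.card B = 2 * Nat.card A)
    (hconjinj : ∀ b ∈ B, (∀ a ∈ A, b * a * b⁻¹ = a) → b = 1)
    (hconjsurj : ∀ f : ↥A ≃* ↥A, ∃ b ∈ B, ∀ a : ↥A, ((f a : G)) = b * (a : G) * b⁻¹) :
    (Subgroup.centralizer (A : Set G)).Normal ∧
      Subgroup.centralizer (A : Set G) ⊓ B = ⊥ ∧
      (∀ g : G, ∃ c ∈ Subgroup.centralizer (A : Set G), ∃ b ∈ B, g = c * b) ∧
      Nat.card ↥(Subgroup.centralizer (A : Set G)) = Nat.card Y ∧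
      (∃ b ∈ B, Nat.card ↥(Subgroup.centralizer (A : Set G)) ≤ orderOf b) ∧
      (∃ W : Subgroup G, W ≤ Subgroup.centralizer (A : Set G) ∧ IsCyclic ↥W ∧
        Nat.card ↥(Subgroup.centralizer (A : Set G)) ≤ 2 * Nat.card W) := by
  classical
  obtain ⟨K, hKn, hKB, hKne⟩ := hBnotcorefree
  have hAK : A ≤ K := hAmin K hKB (fun b _ n hn => hKn.conj_mem n hn b) hKne
  have hApos : 0 < Nat.card A := Nat.card_pos
  -- `A` is normal in `G`
  have hAn : A.Normal := by
    have hcase : K = A ∨ K = B := by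
      have h1 : Nat.card A ∣ Nat.card K := Subgroup.card_dvd_of_le hAK
      have h2 : Nat.card K ∣ Nat.card B := Subgroup.card_dvd_of_le hKB
      obtain ⟨k, hk⟩ := h1
      rw [hk, hindex2, mul_comm 2] at h2
      have h3 : k ∣ 2 := Nat.dvd_of_mul_dvd_mul_left hApos h2
      rcases (Nat.dvd_prime Nat.prime_two).1 h3 with h | h
      · left
        exact (Subgroup.eq_of_le_of_card_ge hAK (by rw [hk, h, mul_one])).symm
      · right
        exact Subgroup.eq_of_le_of_card_ge hKB (by rw [hk, h, hindex2, mul_comm])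
    rcases hcase with h | h
    · exact h ▸ hKn
    · subst h
      constructor
      intro a ha g
      have hle : A ≤ A.map (MulAut.conj g⁻¹).toMonoidHom := by
        apply hAmin
        · rintro x ⟨a, ha, rfl⟩
          exact hKn.conj_mem a (hAK ha) g⁻¹
        · rintro b hb x ⟨a, ha, rfl⟩
          refine ⟨(g * b * g⁻¹) * a * (g * b * g⁻¹)⁻¹,
            hAnormB _ (hKn.conj_mem b hb g) a ha, ?_⟩
          simp [mul_assoc]
        · intro h
          exact hAne ((Subgroup.map_eq_bot_iff_of_injective _
            (MulAut.conj g⁻¹).injective).1 h)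
      obtain ⟨a', ha', h⟩ := hle ha
      have : g * a * g⁻¹ = a' := by
        rw [← h]; simp [mul_assoc]
      rw [this]; exact ha'
  set C := Subgroup.centralizer (A : Set G) with hC
  have hCmem : ∀ g, g ∈ C ↔ ∀ a ∈ A, g * a * g⁻¹ = a := by
    intro g
    rw [hC, Subgroup.mem_centralizer_iff]
    constructor
    · intro h a ha
      rw [← h a ha]; group
    · intro h a ha
      have := h a ha
      rw [mul_inv_eq_iff_eq_mul] at this
      exact this.symm
  have hCn : C.Normal := by
    rw [hC]; infer_instance
  have hCB : C ⊓ B = ⊥ := by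
    rw [eq_bot_iff]
    rintro x ⟨hx, hxB⟩
    exact hconjinj x hxB ((hCmem x).1 hx)
  have hGCB : ∀ g : G, ∃ c ∈ C, ∃ b ∈ B, g = c * b := by
    intro g
    obtain ⟨b, hb, h⟩ := hconjsurj (MulAut.conjNormal g)
    refine ⟨g * b⁻¹, ?_, b, hb, by group⟩
    rw [hCmem]
    intro a ha
    have h1 := h ⟨b⁻¹ * a * b, by simpa using hAn.conj_mem a ha b⁻¹⟩
    simp only [MulAut.conjNormal_apply] at h1
    calc g * b⁻¹ * a * (g * b⁻¹)⁻¹ = g * (b⁻¹ * a * b) * g⁻¹ := by group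
      _ = _ := h1
      _ = a := by group
  have cardBY : Nat.card B * Nat.card Y = Nat.card G := by
    have : Subgroup.IsComplement' B Y := by
      apply Subgroup.isComplement'_of_disjoint_and_mul_eq_univ (disjoint_iff.2 hint)
      ext g
      obtain ⟨b, hb, u, hu, h⟩ := hfact g
      simp only [Set.mem_univ, iff_true]
      exact ⟨b, hb, u, hu, h.symm⟩
    exact this.card_mul_card
  have cardCB : Nat.card C * Nat.card B = Nat.card G := by
    have : Subgroup.IsComplement' C B := by
      apply Subgroup.isComplement'_of_disjoint_and_mul_eq_univ (disjoint_iff.2 hCB)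
      ext g
      obtain ⟨b, hb, u, hu, h⟩ := hGCB g
      simp only [Set.mem_univ, iff_true]
      exact ⟨b, hb, u, hu, h.symm⟩
    exact this.card_mul_card
  have hBpos : 0 < Nat.card B := Nat.card_pos
  have hcard : Nat.card C = Nat.card Y := by
    apply Nat.eq_of_mul_eq_mul_left hBpos
    rw [cardBY, mul_comm, cardCB]
  -- the subgroup `A Y`, of index at most two
  set N := A ⊔ Y with hN
  have cardN : Nat.card A * Nat.card Y ≤ Nat.card N := by
    rw [← Nat.card_prod]
    apply Nat.card_le_card_of_injective
      (fun p : A × Y => (⟨p.1 * p.2, mul_mem (Subgroup.mem_sup_left p.1.2)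
        (Subgroup.mem_sup_right p.2.2)⟩ : N))
    intro p q h
    have h' : (p.1 : G) * p.2 = q.1 * q.2 := congrArg Subtype.val h
    exact Subgroup.mul_injective_of_disjoint
      (disjoint_iff.2 (le_bot_iff.1 (hint ▸ inf_le_inf_right Y hAB))) h'
  have hNidx : N.index ≤ 2 := by
    have h1 : N.index * Nat.card N = Nat.card G := N.index_mul_card
    have hp : 0 < Nat.card N := Nat.card_pos
    rw [← cardBY, hindex2, mul_assoc] at h1
    have h2 : N.index * Nat.card N ≤ 2 * Nat.card N := by
      rw [h1]; exact Nat.mul_le_mul_left 2 cardN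
    exact Nat.le_of_mul_le_mul_right h2 hp
  have hNpos : N.index ≠ 0 := Subgroup.index_ne_zero_of_finite
  have hNn : N.Normal := by
    have : N.index = 1 ∨ N.index = 2 := by omega
    rcases this with h | h
    · rw [Subgroup.index_eq_one.1 h]; infer_instance
    · exact Subgroup.normal_of_index_eq_two h
  have hDn : (N ⊓ C).Normal := inferInstance
  have hDcard : Nat.card C ≤ 2 * Nat.card ↥(N ⊓ C) := by
    have h1 : N.relIndex C * Nat.card ↥(N ⊓ C) = Nat.card C := by
      have h0 := Subgroup.relIndex_mul_relIndex ⊥ (N ⊓ C) C bot_le inf_le_right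
      rw [Subgroup.relIndex_bot_left, Subgroup.relIndex_bot_left,
        Subgroup.inf_relIndex_right] at h0
      rw [mul_comm]; exact h0
    have h2 : N.relIndex C ≤ N.index :=
      Nat.le_of_dvd (Nat.pos_of_ne_zero hNpos) (Subgroup.relIndex_dvd_index_of_normal N C)
    rw [← h1]
    exact Nat.mul_le_mul_right _ (h2.trans hNidx)
  have hDcyc : IsCyclic ↥(N ⊓ C) := by
    let q := QuotientGroup.mk' A
    have hYm : IsCyclic ↥(Y.map q) :=
      isCyclic_of_surjective (q.subgroupMap Y) (q.subgroupMap_surjective Y)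
    have hle : ∀ x : ↥(N ⊓ C), q x ∈ Y.map q := by
      intro x
      have : N.map q = Y.map q := by
        rw [hN, Subgroup.map_sup, QuotientGroup.map_mk'_self, bot_sup_eq]
      rw [← this]
      exact ⟨x, x.2.1, rfl⟩
    let f : ↥(N ⊓ C) →* ↥(Y.map q) := (q.comp (N ⊓ C).subtype).codRestrict _ hle
    apply isCyclic_of_injective f
    rw [injective_iff_map_eq_one]
    intro x hx
    have h1 : q x = 1 := congrArg Subtype.val hx
    have h2 : (x : G) ∈ A := (QuotientGroup.eq_one_iff _).1 h1
    have h3 : (x : G) ∈ C ⊓ B := ⟨x.2.2, hAB h2⟩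
    rw [hCB] at h3
    exact Subtype.ext h3
  have hM : Y ⊓ C = ⊥ := by
    apply hYcorefree _ _ inf_le_left
    obtain ⟨d, hd⟩ := hDcyc.exists_generator
    constructor
    intro m hm g
    have hmD : m ∈ N ⊓ C := ⟨Subgroup.mem_sup_right hm.1, hm.2⟩
    obtain ⟨j, hj⟩ := Subgroup.mem_zpowers_iff.1 (hd ⟨m, hmD⟩)
    obtain ⟨k, hk⟩ := Subgroup.mem_zpowers_iff.1 (hd ⟨g * d * g⁻¹, hDn.conj_mem _ d.2 g⟩)
    have hj' : (d : G) ^ j = m := congrArg Subtype.val hj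
    have hk' : (d : G) ^ k = g * d * g⁻¹ := congrArg Subtype.val hk
    have : g * m * g⁻¹ = m ^ k := by
      rw [← hj', ← conj_zpow, ← hk', ← zpow_mul, ← zpow_mul, mul_comm]
    rw [this]
    exact zpow_mem hm k
  refine ⟨hCn, hCB, hGCB, hcard, ?_, N ⊓ C, inf_le_right, hDcyc, hDcard⟩
  obtain ⟨y, hy⟩ := hYcyc.exists_generator
  obtain ⟨c, hc, b, hb, h⟩ := hGCB y
  refine ⟨b, hb, ?_⟩
  have hoy : orderOf (y : G) = Nat.card Y := by
    rw [Subgroup.orderOf_coe, orderOf_eq_card_of_forall_mem_zpowers hy]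
  rw [hcard, ← hoy]
  apply Nat.le_of_dvd (orderOf_pos b)
  apply orderOf_dvd_of_pow_eq_one
  have h1 : (y : G) ^ orderOf b ∈ Y ⊓ C := by
    refine ⟨pow_mem y.2 _, ?_⟩
    change (y : G) ^ orderOf b ∈ C
    rw [← QuotientGroup.eq_one_iff, QuotientGroup.mk_pow, h, QuotientGroup.mk_mul,
      (QuotientGroup.eq_one_iff c).2 hc, one_mul, ← QuotientGroup.mk_pow, pow_orderOf_eq_one,
      QuotientGroup.mk_one]
  rw [hM] at h1
  exact h1
end
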